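/- Zeros of solutions move strictly left as the initial value increases: let ᾱ < α be positive reals, let ū and u be solutions of the IVP with initial values ᾱ and α respectively, and suppose ū has at least j zeros, with z₁ < ⋯ < z_j its first j zeros. Then u has at least j zeros, and for each i ∈ {1,…,j} the i-th zero of u is strictly smaller than z_i. -/

import Mathlib

open Real Filter Set

/-- The nonlinearity `f(s) = -s + |s|^(p-1) s`. -/
noncomputable def f (p s : ℝ) : ℝ := -s + |s| ^ (p - 1) * s

/-- The derivative of the nonlinearity, `f'(s) = -1 + p |s|^(p-1)`. -/
noncomputable def fder (p s : ℝ) : ℝ := -1 + p * |s| ^ (p - 1)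

/-- The primitive `F(s) = -s^2/2 + |s|^(p+1)/(p+1)`. -/
noncomputable def F (p s : ℝ) : ℝ := -s ^ 2 / 2 + |s| ^ (p + 1) / (p + 1)

/-- `u : [0,∞) → ℝ` (modeled on `Set.Ici 0`) is a C² solution of the IVP
`u'' + ((n-1)/r) u' + f(u) = 0`, `u(0) = α`, `u'(0) = 0`; the data `u'`, `u''`
are its first and second derivatives on `[0,∞)`. -/
structure IsSolution (n : ℕ) (p α : ℝ) (u u' u'' : ℝ → ℝ) : Prop where
  init : u 0 = α
  initDeriv : u' 0 = 0
  hasDeriv1 : ∀ r ∈ Set.Ici (0:ℝ), HasDerivWithinAt u (u' r) (Set.Ici 0) r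
  hasDeriv2 : ∀ r ∈ Set.Ici (0:ℝ), HasDerivWithinAt u' (u'' r) (Set.Ici 0) r
  cont2 : ContinuousOn u'' (Set.Ici 0)
  ode : ∀ r : ℝ, 0 < r → u'' r + ((n : ℝ) - 1) / r * u' r + f p (u r) = 0

/-- The variation `v` associated with a solution `u`: the C² solution of the linearized
equation `v'' + ((n-1)/r) v' + f'(u) v = 0`, `v(0) = 1`, `v'(0) = 0`. -/
structure IsVariation (n : ℕ) (p : ℝ) (u v v' v'' : ℝ → ℝ) : Prop where
  init : v 0 = 1
  initDeriv : v' 0 = 0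
  hasDeriv1 : ∀ r ∈ Set.Ici (0:ℝ), HasDerivWithinAt v (v' r) (Set.Ici 0) r
  hasDeriv2 : ∀ r ∈ Set.Ici (0:ℝ), HasDerivWithinAt v' (v'' r) (Set.Ici 0) r
  cont2 : ContinuousOn v'' (Set.Ici 0)
  ode : ∀ r : ℝ, 0 < r → v'' r + ((n : ℝ) - 1) / r * v' r + fder p (u r) * v r = 0

/-- `u` is decaying: `u(r) → 0` and `u'(r) → 0` as `r → ∞`. -/
def Decaying (u u' : ℝ → ℝ) : Prop :=
  Filter.Tendsto u Filter.atTop (nhds 0) ∧ Filter.Tendsto u' Filter.atTop (nhds 0)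

/-- `u` changes sign on `(0,∞)`. -/
def ChangesSign (u : ℝ → ℝ) : Prop :=
  (∃ r : ℝ, 0 < r ∧ u r < 0) ∧ (∃ r : ℝ, 0 < r ∧ 0 < u r)

/-- `z 0 < z 1 < ⋯ < z (k-1)` are exactly the zeros of `u` in `(0,∞)`. -/
def ExactZeros (u : ℝ → ℝ) (k : ℕ) (z : Fin k → ℝ) : Prop :=
  StrictMono z ∧ (∀ i, 0 < z i ∧ u (z i) = 0) ∧
    ∀ r : ℝ, 0 < r → u r = 0 → ∃ i, r = z i

/-- `z 0 < ⋯ < z (j-1)` are the first `j` zeros of `u` in `(0,∞)`: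
every zero of `u` either is one of them or lies to the right of all of them. -/
def FirstZeros (u : ℝ → ℝ) (j : ℕ) (z : Fin j → ℝ) : Prop :=
  StrictMono z ∧ (∀ i, 0 < z i ∧ u (z i) = 0) ∧
    ∀ r : ℝ, 0 < r → u r = 0 → (∃ i, r = z i) ∨ ∀ i, z i < r

/-- A binary quadratic form is nonnegative on the positive quadrant. -/
theorem quadForm_nonneg {a b c Z X : ℝ} (hZ : 0 ≤ Z) (hX : 0 ≤ X) (ha : 0 ≤ a) (hc : 0 ≤ c)
    (h : b < 0 → b ^ 2 ≤ 4 * a * c) : 0 ≤ a * Z ^ 2 + b * Z * X + c * X ^ 2 := by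
  by_cases hb : b < 0
  · have h1 := h hb
    have hac : 0 < a * c := by nlinarith [sq_pos_of_neg hb]
    have ha' : 0 < a := by
      rcases ha.lt_or_eq with h0 | h0
      · exact h0
      · rw [← h0] at hac; simp at hac
    have : 0 ≤ 4 * a * (a * Z ^ 2 + b * Z * X + c * X ^ 2) := by
      nlinarith [sq_nonneg (2 * a * Z + b * X), mul_nonneg (sub_nonneg.2 h1) (sq_nonneg X)]
    by_contra hneg
    push Not at hneg
    nlinarith
  · push Not at hb
    positivity

theorem barrier_poly_nonneg {s μ P X Z : ℝ} (hs : 0 < s) (hs2 : s ≤ 2) (hμ : 0 < μ)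
    (hμ2 : μ * ((2 + s) * s) ≤ 4 - s) (hP : 0 ≤ P) (hX : 0 ≤ X) (hZ : 0 ≤ Z) :
    0 ≤ (P + s / (s + 2) * X) ^ 2 * ((2 - (s + 4) * μ) * Z + s * μ ^ 2 * X)
      + 4 * (P + s / (s + 2) * X) * Z * (Z + μ * P) - s * X * (Z + μ * P) ^ 2 := by
  obtain ⟨a, ha⟩ : ∃ a, a = s / (s + 2) := ⟨_, rfl⟩
  have hs' : s = a * (s + 2) := by rw [ha]; field_simp
  have ha0 : 0 < a := by rw [ha]; positivity
  have hPform : 0 ≤ 4 * Z ^ 2 + (4 * a * (1 - (s + 2) * μ)) * Z * X + (2 * a * s * μ ^ 2) * X ^ 2 := by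
    apply quadForm_nonneg hZ hX (by norm_num) (by positivity)
    intro hb
    have hb1 : 0 < (s + 2) * μ - 1 := by
      by_contra hcon
      have : 0 ≤ 4 * a * (1 - (s + 2) * μ) := by
        apply mul_nonneg (by positivity); linarith
      linarith
    have key : ((s + 2) * μ - 1) ^ 2 ≤ 2 * (s + 2) * μ ^ 2 := by
      have h4 : 0 < 4 - s := by linarith
      have e1 : (4 - s) * ((s + 2) * μ - 1) ≤ (2 + s) * (4 - 2 * s) * μ := by nlinarith
      have e2 : (4 - s) ^ 2 * ((s + 2) * μ - 1) ^ 2 ≤ ((2 + s) * (4 - 2 * s) * μ) ^ 2 := by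
        rw [← mul_pow]; exact pow_le_pow_left₀ (by positivity) e1 2
      have e3 : ((2 + s) * (4 - 2 * s) * μ) ^ 2 ≤ (4 - s) ^ 2 * (2 * (s + 2) * μ ^ 2) := by
        have : 0 ≤ (s + 2) * μ ^ 2 * (s ^ 2 * (10 - 4 * s)) := by
          have : 0 ≤ 10 - 4 * s := by linarith
          positivity
        nlinarith
      exact le_of_mul_le_mul_left (e2.trans e3) (by positivity)
    have : 4 * 4 * (2 * a * s * μ ^ 2) - (4 * a * (1 - (s + 2) * μ)) ^ 2
        = 16 * a ^ 2 * (2 * (s + 2) * μ ^ 2 - ((s + 2) * μ - 1) ^ 2) := by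
      linear_combination (32 * a * μ ^ 2) * hs'
    nlinarith [mul_nonneg (by positivity : 0 ≤ 16 * a ^ 2) (sub_nonneg.2 key)]
  have hXform : 0 ≤ (4 * a - s) * Z ^ 2 + (a ^ 2 * (2 - (s + 4) * μ)) * Z * X
      + (a ^ 2 * s * μ ^ 2) * X ^ 2 := by
    have h4a : 4 * a - s = a * (2 - s) := by linear_combination - hs'
    rw [h4a]
    apply quadForm_nonneg hZ hX (by apply mul_nonneg ha0.le; linarith) (by positivity)
    intro hb
    have hb1 : 0 < (s + 4) * μ - 2 := by
      by_contra hcon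
      have : 0 ≤ a ^ 2 * (2 - (s + 4) * μ) := by
        apply mul_nonneg (by positivity); linarith
      linarith
    have key : ((s + 4) * μ - 2) ^ 2 ≤ 4 * (2 - s) * (s + 2) * μ ^ 2 := by
      have h4 : 0 < 4 - s := by linarith
      have e1 : (4 - s) * ((s + 4) * μ - 2) ≤ (16 - 4 * s - 3 * s ^ 2) * μ := by nlinarith
      have e0 : 0 < 16 - 4 * s - 3 * s ^ 2 := by
        by_contra hcon
        push Not at hcon
        nlinarith [mul_pos h4 hb1]
      have e2 : (4 - s) ^ 2 * ((s + 4) * μ - 2) ^ 2 ≤ ((16 - 4 * s - 3 * s ^ 2) * μ) ^ 2 := by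
        rw [← mul_pow]; exact pow_le_pow_left₀ (by positivity) e1 2
      have e3 : ((16 - 4 * s - 3 * s ^ 2) * μ) ^ 2 ≤ (4 - s) ^ 2 * (4 * (2 - s) * (s + 2) * μ ^ 2) := by
        have h32 : 0 ≤ 32 + 8 * s - 13 * s ^ 2 := by nlinarith
        have : 0 ≤ μ ^ 2 * (s ^ 2 * (32 + 8 * s - 13 * s ^ 2)) := by positivity
        nlinarith
      exact le_of_mul_le_mul_left (e2.trans e3) (by positivity)
    have : 4 * (a * (2 - s)) * (a ^ 2 * s * μ ^ 2) - (a ^ 2 * (2 - (s + 4) * μ)) ^ 2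
        = a ^ 4 * (4 * (2 - s) * (s + 2) * μ ^ 2 - ((s + 4) * μ - 2) ^ 2) := by
      linear_combination (4 * a ^ 3 * (2 - s) * μ ^ 2) * hs'
    nlinarith [mul_nonneg (by positivity : 0 ≤ a ^ 4) (sub_nonneg.2 key)]
  have hm : 0 ≤ 2 - s * μ := by
    by_contra hcon
    push Not at hcon
    nlinarith
  rw [← ha]
  have id : (P + a * X) ^ 2 * ((2 - (s + 4) * μ) * Z + s * μ ^ 2 * X)
      + 4 * (P + a * X) * Z * (Z + μ * P) - s * X * (Z + μ * P) ^ 2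
      = (2 - s * μ) * Z * P ^ 2
        + P * (4 * Z ^ 2 + (4 * a * (1 - (s + 2) * μ)) * Z * X + (2 * a * s * μ ^ 2) * X ^ 2)
        + X * ((4 * a - s) * Z ^ 2 + (a ^ 2 * (2 - (s + 4) * μ)) * Z * X
          + (a ^ 2 * s * μ ^ 2) * X ^ 2) := by
    linear_combination (-2 * μ * X * P * Z) * hs'
  rw [id]
  positivity

theorem mul_lower_bound {h R σ P x : ℝ} (h0 : 0 ≤ h) (h1 : h ≤ 1 / 2) (hσ : 0 ≤ σ)
    (hP : 0 ≤ P) (hx1 : x ≤ P + 1 / 2) (hx2 : -(P + 1 / 2) ≤ x)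
    (hRP : R + P = x ^ 2 - 1 / 4 + σ * (1 / 2 + h)) :
    (P + σ + (3 / 2 + h)) * R ≤ (P + σ) * (R + (3 / 2 + h) * (P + 1)) := by
  have hRle : R ≤ P ^ 2 + σ := by nlinarith
  have : R ≤ (P + σ) * (P + 1) := by nlinarith [mul_nonneg hP hσ]
  nlinarith

set_option maxHeartbeats 2000000 in
theorem tail_poly_nonneg {h R σ P x b : ℝ} (h0 : 0 ≤ h) (h1 : h ≤ 1 / 2) (hR : 0 < R) (hσ : 0 ≤ σ)
    (hP : 0 ≤ P) (hx1 : x ≤ P + 1 / 2) (hx2 : -(P + 1 / 2) ≤ x)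
    (hRP : R + P = x ^ 2 - 1 / 4 + σ * (1 / 2 + h)) (hb : b * (1 + 2 * h) = 2 * (1 - 2 * h))
    {c κ D Q y : ℝ} (hc : c = 3 / 2 + h) (hκ : κ = 5 / 4 + h + h ^ 2) (hD : D = R + c * (P + 1))
    (hQ : Q = P + σ) (hy : y = x - h) :
    0 ≤ Q * (2 * (1 - h) * Q * D ^ 2 + R * (D * ((3 + 4 * h) * P + 2 * h * σ)
      + 2 * h * c * σ * y - 2 * c * x * y * P)) + κ * R * (D * (4 * P - b * σ) + 2 * y * R) := by
  have hc0 : 0 < c := by linarith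
  have hκ0 : 0 < κ := by rw [hκ]; positivity
  have hQ0 : 0 ≤ Q := by rw [hQ]; positivity
  have hD0 : 0 < D := by rw [hD]; positivity
  have hK : (Q + c) * R ≤ Q * D := by
    rw [hQ, hD, hc]; exact mul_lower_bound h0 h1 hσ hP hx1 hx2 hRP
  have hb0 : 0 ≤ b := by
    by_contra hcon
    push Not at hcon
    nlinarith
  have hRle : R ≤ P ^ 2 + σ * (1 / 2 + h) := by nlinarith
  -- the linear-in-`σ` condition
  have hlin : κ * b + κ * (1 / 2 + h) ^ 2 * 2 / c ≤ 2 * (1 - h) * c := by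
    have hT : 0 < 1 + 2 * h := by linarith
    have hb' : b = 2 * (1 - 2 * h) / (1 + 2 * h) := by field_simp; linarith
    rw [hb', hκ, hc, ← sub_nonneg]
    have : 2 * (1 - h) * (3 / 2 + h) - ((5 / 4 + h + h ^ 2) * (2 * (1 - 2 * h) / (1 + 2 * h))
        + (5 / 4 + h + h ^ 2) * (1 / 2 + h) ^ 2 * 2 / (3 / 2 + h))
        = (2 * (1 - h) * (3 / 2 + h) ^ 2 * (1 + 2 * h)
          - (5 / 4 + h + h ^ 2) * (2 * (1 - 2 * h) * (3 / 2 + h)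
          + (1 / 2 + h) ^ 2 * 2 * (1 + 2 * h))) / ((1 + 2 * h) * (3 / 2 + h)) := by
      have : 3 / 2 + h ≠ 0 := by linarith
      field_simp
    rw [this]
    apply div_nonneg _ (by positivity)
    obtain ⟨k, rfl⟩ : ∃ k, h = 1 / 2 - k := ⟨1 / 2 - h, by ring⟩
    have hk : 0 ≤ k := by linarith
    have hk2 : k ≤ 1 / 2 := by linarith
    ring_nf
    nlinarith [mul_nonneg hk hk, mul_nonneg (mul_nonneg hk hk) hk, mul_nonneg hk (sub_nonneg.2 hk2), mul_nonneg (mul_nonneg hk hk) (sub_nonneg.2 hk2), pow_nonneg hk 4, pow_nonneg hk 5]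
  have hxy : x * y ≤ D := by
    rw [hy, hD, hc]
    have : R = x ^ 2 - 1 / 4 + σ * (1 / 2 + h) - P := by linarith
    rw [this]
    nlinarith [mul_nonneg h0 hP, mul_nonneg h0 (by linarith : 0 ≤ x + (P + 1 / 2)),
      mul_nonneg hσ (by linarith : 0 ≤ 1 / 2 + h)]
  have hyl : -(P + 1 / 2 + h) ≤ y := by rw [hy]; linarith
  have hcy : -D ≤ c * y := by
    have : c * (-(P + 1)) ≤ c * y := mul_le_mul_of_nonneg_left (by linarith) hc0.le
    rw [hD]; linarith
  have hRD : R * c ≤ D * (P + σ * (1 / 2 + h)) := by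
    have h2 : 0 ≤ σ * (1 / 2 + h) := by positivity
    have : R * c ≤ c * (P + 1) * (P + σ * (1 / 2 + h)) := by
      have : R ≤ (P + 1) * (P + σ * (1 / 2 + h)) := by nlinarith [mul_nonneg hP h2]
      calc R * c ≤ (P + 1) * (P + σ * (1 / 2 + h)) * c := by gcongr
        _ = _ := by ring
    have h3 : 0 ≤ R * (P + σ * (1 / 2 + h)) := by positivity
    rw [hD]; linarith
  have hRD' : R ≤ D * ((P + σ * (1 / 2 + h)) / c) := by
    rw [← mul_div_assoc, le_div_iff₀ hc0]; exact hRD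
  have hyR : -(D * (P + (1 / 2 + h) * ((P + σ * (1 / 2 + h)) / c))) ≤ y * R := by
    have e1 : -(P + 1 / 2 + h) * R ≤ y * R := mul_le_mul_of_nonneg_right hyl hR.le
    have e2 : R ≤ D := by rw [hD]; nlinarith
    have e3 : P * R ≤ P * D := mul_le_mul_of_nonneg_left e2 hP
    have e4 : (1 / 2 + h) * R ≤ (1 / 2 + h) * (D * ((P + σ * (1 / 2 + h)) / c)) :=
      mul_le_mul_of_nonneg_left hRD' (by linarith)
    linarith
  have hfin : 0 ≤ 2 * (1 - h) * Q * (Q + c) + Q * (2 * h * P) + κ * (4 * P - b * σ)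
      - 2 * κ * (P + (1 / 2 + h) * ((P + σ * (1 / 2 + h)) / c)) := by
    have e1 : 2 * κ * ((1 / 2 + h) * (P / c)) ≤ 2 * κ * P := by
      apply mul_le_mul_of_nonneg_left _ (by positivity)
      rw [← mul_div_assoc, div_le_iff₀ hc0]
      rw [hc]; nlinarith
    have e2 : σ * (κ * b + κ * (1 / 2 + h) ^ 2 * 2 / c) ≤ σ * (2 * (1 - h) * c) :=
      mul_le_mul_of_nonneg_left hlin hσ
    have e3 : 0 ≤ (1 - h) * (Q * Q) := mul_nonneg (by linarith) (by positivity)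
    have e4 : 0 ≤ (1 - h) * (P * c) := mul_nonneg (by linarith) (by positivity)
    have e5 : 0 ≤ Q * (2 * h * P) := by positivity
    have e6 : (P + σ * (1 / 2 + h)) / c = P / c + σ * (1 / 2 + h) / c := by ring
    have e7 : σ * (κ * (1 / 2 + h) ^ 2 * 2 / c)
        = 2 * κ * ((1 / 2 + h) * (σ * (1 / 2 + h) / c)) := by ring
    have e8 : 2 * (1 - h) * Q * (Q + c)
        = 2 * ((1 - h) * (Q * Q)) + 2 * ((1 - h) * (P * c)) + σ * (2 * (1 - h) * c) := by
      rw [hQ]; ring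
    rw [e6, e8]
    linarith
  have t1 : 2 * (1 - h) * Q * D * ((Q + c) * R) ≤ 2 * (1 - h) * Q * D * (Q * D) := by
    apply mul_le_mul_of_nonneg_left hK
    have : 0 ≤ 1 - h := by linarith
    positivity
  have t2 : R * Q * (2 * h * σ) * (-D) ≤ R * Q * (2 * h * σ) * (c * y) :=
    mul_le_mul_of_nonneg_left hcy (by positivity)
  have t3 : R * Q * (2 * c * P) * (x * y) ≤ R * Q * (2 * c * P) * D :=
    mul_le_mul_of_nonneg_left hxy (by positivity)
  have t4 : 2 * κ * R * -(D * (P + (1 / 2 + h) * ((P + σ * (1 / 2 + h)) / c)))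
      ≤ 2 * κ * R * (y * R) := mul_le_mul_of_nonneg_left hyR (by positivity)
  have t5 := mul_nonneg (mul_nonneg hR.le hD0.le) hfin
  have t6 : 2 * c = 3 + 2 * h := by rw [hc]; ring
  have t7 : R * Q * (2 * c * P) * D = R * Q * ((3 + 2 * h) * P) * D := by rw [t6]
  linarith

theorem barrier_low_nonneg {N s μ m u q ρ e : ℝ} (hs : 0 < s) (hs2 : s ≤ 2) (hN : 1 ≤ N)
    (hNs : N * s < 4) (hm : m = (4 - N * s) / (s + 2)) (hμ : μ = m / s) (hρ : 0 < ρ) (he : 0 ≤ e)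
    {X Z P Q dZ dX dP : ℝ} (hX : X = ρ * e * u ^ 2) (hZ : Z = ρ * u ^ 2)
    (hQ : Q = P + s / (s + 2) * X) (hdZ : dZ = 2 * Z + 2 * ρ * u * q) (hdX : dX = 2 * X + (s + 2) * (ρ * e * u * q))
    (hdP : dP = -N * P + m * X - 2 * Z) (hP0 : 0 < P) :
    0 ≤ ((dZ + μ * dP) * Q - (Z + μ * P) * (dP + s / (s + 2) * dX)) / Q ^ 2
      + ρ / Q * (s * e * ((Z + μ * P) / Q) - 2)
        * (u * (q + 2 / s * u) - u ^ 2 * ((Z + μ * P) / Q)) := by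
  have hX0 : 0 ≤ X := by rw [hX]; positivity
  have hZ0 : 0 ≤ Z := by rw [hZ]; positivity
  have hQ0 : 0 < Q := by rw [hQ]; positivity
  have hm0 : 0 < m := by rw [hm]; apply div_pos <;> linarith
  have hμ0 : 0 < μ := by rw [hμ]; positivity
  have hms : m = s * μ := by rw [hμ]; field_simp
  have hms2 : m * (s + 2) = 4 - N * s := by rw [hm]; field_simp
  have hμ2 : μ * ((2 + s) * s) ≤ 4 - s := by
    have : μ * ((2 + s) * s) = m * (s + 2) := by rw [hms]; ring
    rw [this, hms2]; nlinarith
  have key := barrier_poly_nonneg hs hs2 hμ0 hμ2 hP0.le hX0 hZ0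
  have hNe : N = (4 - s * μ * (s + 2)) / s := by
    rw [← hms, hms2]; field_simp; ring
  have e1 : ((dZ + μ * dP) * Q - (Z + μ * P) * (dP + s / (s + 2) * dX)) / Q ^ 2
      + ρ / Q * (s * e * ((Z + μ * P) / Q) - 2)
        * (u * (q + 2 / s * u) - u ^ 2 * ((Z + μ * P) / Q))
      = ((P + s / (s + 2) * X) ^ 2 * ((2 - (s + 4) * μ) * Z + s * μ ^ 2 * X)
      + 4 * (P + s / (s + 2) * X) * Z * (Z + μ * P) - s * X * (Z + μ * P) ^ 2) / Q ^ 3 := by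
    have e2 : ρ / Q * (s * e * ((Z + μ * P) / Q) - 2)
        * (u * (q + 2 / s * u) - u ^ 2 * ((Z + μ * P) / Q))
        = ((s * (Z + μ * P) * ((ρ * e * u * q + 2 / s * X) * Q - X * (Z + μ * P)))
          - 2 * Q * ((ρ * u * q + 2 / s * Z) * Q - Z * (Z + μ * P))) / Q ^ 3 := by
      rw [hX, hZ]; field_simp
    rw [e2, hdX, hdZ, hdP, hms, hNe]
    generalize ρ * e * u * q = A1
    generalize hA2 : ρ * u * q = A2
    have : 2 * ρ * u * q = 2 * A2 := by rw [← hA2]; ring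
    rw [this, hQ]
    field_simp
    ring
  rw [e1]
  positivity

theorem tail_den_pos {h u q ρ e : ℝ} (h0 : 0 ≤ h) (h1 : h ≤ 1 / 2) (hρ : 0 < ρ) (he : 0 ≤ e)
    {c X Z P Q D : ℝ} (hc : c = 3 / 2 + h) (hX : X = ρ * e * u ^ 2) (hZ : Z = ρ * u ^ 2)
    (hP : P = q ^ 2 + u * q - ρ * u ^ 2 + (1 + 2 * h) / (2 * c) * X) (hQ : Q = P + X / c)
    (hD : D = Z + c * P + c * u ^ 2) (hP0 : 0 < P) (hE : 0 ≤ P + u ^ 2 + u * q)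
    (hH : 0 ≤ P - u * q) :
    0 < Q * D + (u ^ 2 / 2 + u * q - h * u ^ 2) * Z := by
  have hc0 : 0 < c := by linarith
  by_cases hu : u = 0
  · subst hu
    have : X = 0 := by rw [hX]; ring
    rw [hD, hQ, hZ, this]
    norm_num
    positivity
  obtain ⟨x, rfl⟩ : ∃ x, q = (x - 1 / 2) * u := ⟨q / u + 1 / 2, by field_simp; ring⟩
  obtain ⟨w, rfl⟩ : ∃ w, P = w * u ^ 2 := ⟨P / u ^ 2, by field_simp⟩
  have hu2 : 0 < u ^ 2 := by positivity
  have hw0 : 0 < w := pos_of_mul_pos_left hP0 hu2.le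
  have hx2 : 0 ≤ w + 1 / 2 + x := by
    have : 0 ≤ (w + 1 / 2 + x) * u ^ 2 := by linarith
    exact nonneg_of_mul_nonneg_left this hu2
  have hx1 : 0 ≤ w + 1 / 2 - x := by
    have : 0 ≤ (w + 1 / 2 - x) * u ^ 2 := by linarith
    exact nonneg_of_mul_nonneg_left this hu2
  have hrel : ρ + w = x ^ 2 - 1 / 4 + ρ * e / c * (1 / 2 + h) := by
    have : (ρ + w) * u ^ 2 = (x ^ 2 - 1 / 4 + ρ * e / c * (1 / 2 + h)) * u ^ 2 := by
      rw [hX] at hP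
      rw [add_mul, hP]
      field_simp; ring
    exact mul_right_cancel₀ hu2.ne' this
  have hσ : 0 ≤ ρ * e / c := by positivity
  have key := mul_lower_bound h0 h1 hσ hw0.le (by linarith) (by linarith) hrel
  have : Q * D + (u ^ 2 / 2 + u * ((x - 1 / 2) * u) - h * u ^ 2) * Z
      = u ^ 2 * u ^ 2 * ((w + ρ * e / c) * (ρ + (3 / 2 + h) * (w + 1)) + (x - h) * ρ) := by
    rw [hQ, hD, hX, hZ, hc]; ring
  rw [this]
  apply mul_pos (by positivity)
  have : 0 < (w + ρ * e / c + (3 / 2 + h) + (x - h)) * ρ := by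
    apply mul_pos _ hρ; linarith
  linarith

set_option maxHeartbeats 2000000 in
theorem barrier_tail_nonneg {h s u q ρ e : ℝ} (h0 : 0 ≤ h) (h1 : h ≤ 1 / 2)
    (hs : s * (1 + 2 * h) = 4) (hρ : 0 < ρ) (he : 0 ≤ e)
    {c X Z P Q D Y B dX dZ dP dQ dD dY : ℝ} (hc : c = 3 / 2 + h)
    (hX : X = ρ * e * u ^ 2) (hZ : Z = ρ * u ^ 2)
    (hP : P = q ^ 2 + u * q - ρ * u ^ 2 + (1 + 2 * h) / (2 * c) * X) (hQ : Q = P + X / c)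
    (hD : D = Z + c * P + c * u ^ 2) (hY : Y = u ^ 2 / 2 + u * q - h * u ^ 2)
    (hB : B = Z * D / (Q * D + Y * Z))
    (hdX : dX = 2 * X + (s + 2) * (ρ * e * u * q)) (hdZ : dZ = 2 * Z + 2 * ρ * u * q)
    (hdP : dP = -P + 2 * h / c * X - 2 * Z) (hdQ : dQ = dP + dX / c)
    (hdD : dD = dZ + c * dP + c * (2 * u * q))
    (hdY : dY = u * q + q ^ 2 + u * (-q + ρ * u - ρ * e * u) - h * (2 * u * q))
    (hP0 : 0 < P) (hE : 0 ≤ P + u ^ 2 + u * q) (hH : 0 ≤ P - u * q) :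
    0 ≤ ((dZ * D + Z * dD) * (Q * D + Y * Z) - Z * D * (dQ * D + Q * dD + (dY * Z + Y * dZ)))
        / (Q * D + Y * Z) ^ 2
      + ρ / Q * (s * e * B - 2) * (u * (q + (1 / 2 + h) * u) - u ^ 2 * B) := by
  have hc0 : 0 < c := by linarith
  have hden := tail_den_pos h0 h1 hρ he hc hX hZ hP hQ hD hP0 hE hH
  rw [← hY] at hden
  by_cases hu : u = 0
  · subst hu
    have z1 : Z = 0 := by rw [hZ]; ring
    have z2 : dZ = 0 := by rw [hdZ, z1]; ring
    simp [z1, z2]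
  have hT : 0 < 1 + 2 * h := by linarith
  have hs' : s = 4 / (1 + 2 * h) := by field_simp; linarith
  have hs0 : 0 < s := by rw [hs']; positivity
  obtain ⟨x, rfl⟩ : ∃ x, q = (x - 1 / 2) * u := ⟨q / u + 1 / 2, by field_simp; ring⟩
  obtain ⟨w, rfl⟩ : ∃ w, P = w * u ^ 2 := ⟨P / u ^ 2, by field_simp⟩
  have hu2 : 0 < u ^ 2 := by positivity
  have hw0 : 0 < w := pos_of_mul_pos_left hP0 hu2.le
  have hx2 : 0 ≤ w + 1 / 2 + x := by
    have : 0 ≤ (w + 1 / 2 + x) * u ^ 2 := by linarith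
    exact nonneg_of_mul_nonneg_left this hu2
  have hx1 : 0 ≤ w + 1 / 2 - x := by
    have : 0 ≤ (w + 1 / 2 - x) * u ^ 2 := by linarith
    exact nonneg_of_mul_nonneg_left this hu2
  have hrel : ρ + w = x ^ 2 - 1 / 4 + ρ * e / c * (1 / 2 + h) := by
    have : (ρ + w) * u ^ 2 = (x ^ 2 - 1 / 4 + ρ * e / c * (1 / 2 + h)) * u ^ 2 := by
      rw [hX] at hP
      rw [add_mul, hP]
      field_simp; ring
    exact mul_right_cancel₀ hu2.ne' this
  obtain ⟨σ, hσ⟩ : ∃ σ, σ = ρ * e / c := ⟨_, rfl⟩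
  have hσ0 : 0 ≤ σ := by rw [hσ]; positivity
  have hρe : ρ * e = c * σ := by rw [hσ]; field_simp
  rw [← hσ] at hrel
  have key := tail_poly_nonneg (b := s - 2) h0 h1 hρ hσ0 hw0.le (by linarith) (by linarith) hrel
    (by linarith) hc (κ := 5 / 4 + h + h ^ 2) rfl rfl rfl (y := x - h) rfl
  have hX' : X = c * σ * u ^ 2 := by rw [hX, hρe]
  set D' := ρ + c * (w + 1) with hD'
  set Q' := w + σ with hQ'
  have eD : D = D' * u ^ 2 := by rw [hD, hZ, hD']; ring
  have eQ : Q = Q' * u ^ 2 := by rw [hQ, hX', hQ']; field_simp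
  have eY : Y = (x - h) * u ^ 2 := by rw [hY]; ring
  have hden' : 0 < Q' * D' + (x - h) * ρ := by
    have : Q * D + Y * Z = (Q' * D' + (x - h) * ρ) * (u ^ 2) ^ 2 := by
      rw [eD, eQ, eY, hZ]; ring
    rw [this] at hden
    exact pos_of_mul_pos_left hden (by positivity)
  have hQ0 : 0 < Q' := by rw [hQ']; positivity
  have eB : B = ρ * D' / (Q' * D' + (x - h) * ρ) := by
    rw [hB, eD, eQ, eY, hZ]
    field_simp
  have edZ : dZ = (2 * ρ * (x + 1 / 2)) * u ^ 2 := by rw [hdZ, hZ]; ring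
  have edP : dP = (-w + 2 * h * σ - 2 * ρ) * u ^ 2 := by
    rw [hdP, hX', hZ]; field_simp
  have edX : dX / c = (2 * σ + (s + 2) * σ * (x - 1 / 2)) * u ^ 2 := by
    rw [hdX, hX']
    have : ρ * e * u * ((x - 1 / 2) * u) = c * σ * (x - 1 / 2) * u ^ 2 := by rw [hρe]; ring
    rw [this]; field_simp
  set dD' := 2 * ρ * (x + 1 / 2) + c * (-w + 2 * h * σ - 2 * ρ) + c * (2 * (x - 1 / 2)) with hdD'
  set dQ' := -w + 2 * h * σ - 2 * ρ + (2 * σ + (s + 2) * σ * (x - 1 / 2)) with hdQ'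
  set dY' := (x - 1 / 2) + (x - 1 / 2) ^ 2 + (-(x - 1 / 2) + ρ - c * σ) - h * (2 * (x - 1 / 2))
    with hdY'
  have edD : dD = dD' * u ^ 2 := by rw [hdD, edZ, edP, hdD']; ring
  have edQ : dQ = dQ' * u ^ 2 := by rw [hdQ, edP, edX, hdQ']; ring
  have edY : dY = dY' * u ^ 2 := by rw [hdY, hρe, hdY']; ring
  have hw : s * e = s * (c * σ) / ρ := by rw [← hρe]; field_simp
  have e1 : ((dZ * D + Z * dD) * (Q * D + Y * Z)
        - Z * D * (dQ * D + Q * dD + (dY * Z + Y * dZ))) / (Q * D + Y * Z) ^ 2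
      = (((2 * ρ * (x + 1 / 2)) * D' + ρ * dD') * (Q' * D' + (x - h) * ρ) - ρ * D' *
        (dQ' * D' + Q' * dD' + (dY' * ρ + (x - h) * (2 * ρ * (x + 1 / 2)))))
          / (Q' * D' + (x - h) * ρ) ^ 2 := by
    rw [edZ, eD, edD, eQ, eY, edQ, edY, hZ]
    have : (Q' * u ^ 2 * (D' * u ^ 2) + (x - h) * u ^ 2 * (ρ * u ^ 2)) ^ 2
      = (Q' * D' + (x - h) * ρ) ^ 2 * u ^ 8 := by ring
    rw [this, div_eq_div_iff (by positivity) (by positivity)]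
    ring
  have e2 : ρ / Q * (s * e * B - 2) * (u * ((x - 1 / 2) * u + (1 / 2 + h) * u) - u ^ 2 * B)
      = 1 / Q' * (s * (c * σ) * B - 2 * ρ) * (x + h - B) := by
    rw [eQ, hw]; field_simp; ring
  rw [e1, e2, eB]
  have e3 : (((2 * ρ * (x + 1 / 2)) * D' + ρ * dD') * (Q' * D' + (x - h) * ρ) - ρ * D' *
        (dQ' * D' + Q' * dD' + (dY' * ρ + (x - h) * (2 * ρ * (x + 1 / 2)))))
          / (Q' * D' + (x - h) * ρ) ^ 2 + 1 / Q' * (s * (c * σ) *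
          (ρ * D' / (Q' * D' + (x - h) * ρ)) - 2 * ρ) *
          (x + h - ρ * D' / (Q' * D' + (x - h) * ρ))
      = ρ * (Q' * (2 * (1 - h) * Q' * D' ^ 2 + ρ * (D' * ((3 + 4 * h) * w + 2 * h * σ)
      + 2 * h * c * σ * (x - h) - 2 * c * x * (x - h) * w))
      + (5 / 4 + h + h ^ 2) * ρ * (D' * (4 * w - (s - 2) * σ) + 2 * (x - h) * ρ))
        / (Q' * (Q' * D' + (x - h) * ρ) ^ 2) := by
    have hne := hden'.ne'
    have hne2 := hQ0.ne'
    have hrat : ∀ A Δ E s₁ s₂ : ℝ, Δ ≠ 0 → A / Δ ^ 2 + 1 / Q' * (s₁ * (E / Δ) - 2 * ρ) * (s₂ - E / Δ)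
        = (Q' * A + (s₁ * E - 2 * ρ * Δ) * (s₂ * Δ - E)) / (Q' * Δ ^ 2) := by
      intro A Δ E s₁ s₂ hΔ
      field_simp
      try ring
    rw [hrat _ _ _ _ _ hne]
    congr 1
    have hρ' : ρ = x ^ 2 - 1 / 4 + σ * (1 / 2 + h) - w := by linarith
    have hsc : s * (c * σ) = (s + 2) * σ := by rw [hc]; linear_combination (σ / 2) * hs
    rw [hsc, hdQ', hdD', hdY', hQ', hD', hc, hs']
    clear * - hρ' hT
    rw [hρ']
    field_simp
    ring
  rw [e3]
  positivity

theorem antitoneOn_Icc_of_hasDerivAt {a b : ℝ} {G G' : ℝ → ℝ} (hc : ContinuousOn G (Icc a b))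
    (hd : ∀ x ∈ Ioo a b, HasDerivAt G (G' x) x) (h : ∀ x ∈ Ioo a b, G' x ≤ 0) :
    AntitoneOn G (Icc a b) := by
  apply antitoneOn_of_hasDerivWithinAt_nonpos (convex_Icc a b) hc (f' := G')
  · intro x hx; rw [interior_Icc] at hx; exact (hd x hx).hasDerivWithinAt
  · intro x hx; rw [interior_Icc] at hx; exact h x hx

theorem monotoneOn_Icc_of_hasDerivAt {a b : ℝ} {G G' : ℝ → ℝ} (hc : ContinuousOn G (Icc a b))
    (hd : ∀ x ∈ Ioo a b, HasDerivAt G (G' x) x) (h : ∀ x ∈ Ioo a b, 0 ≤ G' x) :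
    MonotoneOn G (Icc a b) := by
  apply monotoneOn_of_hasDerivWithinAt_nonneg (convex_Icc a b) hc (f' := G')
  · intro x hx; rw [interior_Icc] at hx; exact (hd x hx).hasDerivWithinAt
  · intro x hx; rw [interior_Icc] at hx; exact h x hx

/-- Positivity is propagated by a linear cooperative system. -/
theorem cooperative_pos {a b K : ℝ} (hab : a ≤ b) {A H A' H' : ℝ → ℝ}
    (hA : ∀ t ∈ Icc a b, HasDerivAt A (A' t) t) (hH : ∀ t ∈ Icc a b, HasDerivAt H (H' t) t)
    (hAa : 0 < A a) (hHa : 0 < H a)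
    (h1 : ∀ t ∈ Icc a b, 0 ≤ A t → 0 ≤ H t → -K * A t ≤ A' t)
    (h2 : ∀ t ∈ Icc a b, 0 ≤ A t → 0 ≤ H t → -K * H t ≤ H' t) : 0 < A b ∧ 0 < H b := by
  by_contra hcon
  have cA : ContinuousOn A (Icc a b) := fun t ht => (hA t ht).continuousAt.continuousWithinAt
  have cH : ContinuousOn H (Icc a b) := fun t ht => (hH t ht).continuousAt.continuousWithinAt
  let S := {t ∈ Icc a b | min (A t) (H t) ∈ Iic 0}
  have hSc : IsClosed S := (continuous_min.comp_continuousOn (cA.prodMk cH)).preimage_isClosed_of_isClosed isClosed_Icc isClosed_Iic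
  have hSne : S.Nonempty := by
    refine ⟨b, right_mem_Icc.2 hab, ?_⟩
    by_contra hb
    simp only [mem_Iic, not_le, lt_min_iff] at hb
    exact hcon hb
  have hSb : BddBelow S := ⟨a, fun t ht => ht.1.1⟩
  have ht0 := hSc.csInf_mem hSne hSb
  set t0 := sInf S
  have hpos : ∀ t ∈ Ico a t0, 0 < A t ∧ 0 < H t := by
    intro t ht
    by_contra hb
    have : t ∈ S := by
      refine ⟨⟨ht.1, ht.2.le.trans ht0.1.2⟩, ?_⟩
      simp only [mem_Iic]
      by_contra h3
      push Not at h3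
      exact hb (lt_min_iff.1 h3)
    exact absurd (csInf_le hSb this) (not_le.2 ht.2)
  have main : ∀ G G' : ℝ → ℝ, (∀ t ∈ Icc a b, HasDerivAt G (G' t) t) → 0 < G a →
      (∀ t ∈ Ioo a t0, -K * G t ≤ G' t) → 0 < G t0 := by
    intro G G' hG hGa hle
    have hd : ∀ t ∈ Icc a b, HasDerivAt (fun t => exp (K * t) * G t)
        (exp (K * t) * (K * 1) * G t + exp (K * t) * G' t) t := fun t ht =>
      (((hasDerivAt_id t).const_mul K).exp).mul (hG t ht)
    have hmono : MonotoneOn (fun t => exp (K * t) * G t) (Icc a t0) := by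
      apply monotoneOn_Icc_of_hasDerivAt
      · intro t ht
        exact (hd t ⟨ht.1, ht.2.trans ht0.1.2⟩).continuousAt.continuousWithinAt
      · intro t ht
        exact hd t ⟨ht.1.le, ht.2.le.trans ht0.1.2⟩
      · intro t ht
        have := hle t ht
        have e := exp_pos (K * t)
        nlinarith
    have := hmono (left_mem_Icc.2 ht0.1.1) (right_mem_Icc.2 ht0.1.1) ht0.1.1
    have h4 : 0 < exp (K * t0) * G t0 := lt_of_lt_of_le (by positivity) this
    exact pos_of_mul_pos_right h4 (exp_pos _).le
  have mem : ∀ t ∈ Ioo a t0, t ∈ Icc a b := fun t ht => ⟨ht.1.le, ht.2.le.trans ht0.1.2⟩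
  have r1 := main A A' hA hAa fun t ht =>
    h1 t (mem t ht) (hpos t ⟨ht.1.le, ht.2⟩).1.le (hpos t ⟨ht.1.le, ht.2⟩).2.le
  have r2 := main H H' hH hHa fun t ht =>
    h2 t (mem t ht) (hpos t ⟨ht.1.le, ht.2⟩).1.le (hpos t ⟨ht.1.le, ht.2⟩).2.le
  have := ht0.2
  simp only [mem_Iic, min_le_iff] at this
  rcases this with h | h <;> linarith

theorem hasDerivAt_abs_rpow_mul {s : ℝ} (hs : 0 < s) (x : ℝ) :
    HasDerivAt (fun x : ℝ => |x| ^ s * x) ((s + 1) * |x| ^ s) x := by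
  rcases eq_or_ne x 0 with rfl | hx
  · rw [hasDerivAt_iff_tendsto_slope]
    simp only [abs_zero, zero_rpow hs.ne', mul_zero]
    have h0 : Tendsto (fun x : ℝ => |x| ^ s) (nhdsWithin 0 {0}ᶜ) (nhds 0) := by
      have : ContinuousAt (fun x : ℝ => |x| ^ s) 0 :=
        (continuous_abs.continuousAt).rpow_const (Or.inr hs.le)
      have h2 := this.tendsto
      simp only [abs_zero, zero_rpow hs.ne'] at h2
      exact h2.mono_left nhdsWithin_le_nhds
    refine h0.congr' ?_
    filter_upwards [self_mem_nhdsWithin] with y hy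
    have : y ≠ 0 := hy
    simp [slope_def_field, zero_rpow hs.ne']
    field_simp
  · have h1 : HasDerivAt (fun x : ℝ => |x| ^ s) ((SignType.sign x : ℝ) * s * |x| ^ (s - 1)) x :=
      (hasDerivAt_abs hx).rpow_const (Or.inl (abs_ne_zero.2 hx))
    have h2 := h1.mul (hasDerivAt_id x)
    have h3 : |x| ^ s = |x| ^ (s - 1) * |x| := by
      rw [← rpow_add_one (abs_ne_zero.2 hx)]; ring_nf
    have h4 : (SignType.sign x : ℝ) * x = |x| := sign_mul_self x
    refine h2.congr_deriv ?_
    change _ * x + |x| ^ s * 1 = _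
    rw [h3]
    linear_combination (s * |x| ^ (s - 1)) * h4

theorem hasDerivAt_f {p : ℝ} (hp : 1 < p) (s : ℝ) : HasDerivAt (f p) (fder p s) s := by
  have h := (hasDerivAt_neg s).add (hasDerivAt_abs_rpow_mul (sub_pos.2 hp) s)
  have : fder p s = -1 + (p - 1 + 1) * |s| ^ (p - 1) := by unfold fder; ring
  rw [this]
  exact h

theorem continuous_abs_rpow {s : ℝ} (hs : 0 < s) : Continuous fun x : ℝ => |x| ^ s :=
  continuous_abs.rpow_const fun _ => Or.inr hs.le

theorem continuous_f {p : ℝ} (hp : 1 < p) : Continuous (f p) :=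
  continuous_neg.add ((continuous_abs_rpow (sub_pos.2 hp)).mul continuous_id)

theorem continuous_fder {p : ℝ} (hp : 1 < p) : Continuous (fder p) :=
  continuous_const.add (continuous_const.mul (continuous_abs_rpow (sub_pos.2 hp)))

theorem hasDerivAt_abs_rpow_mul_sq {p : ℝ} (hp : 1 < p) (s : ℝ) :
    HasDerivAt (fun s : ℝ => |s| ^ (p - 1) * s ^ 2) ((p + 1) * (|s| ^ (p - 1) * s)) s := by
  have h := (hasDerivAt_abs_rpow_mul (sub_pos.2 hp) s).mul (hasDerivAt_id s)
  have e : (fun s : ℝ => |s| ^ (p - 1) * s ^ 2) = (fun x : ℝ => |x| ^ (p - 1) * x) * id := by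
    funext x
    change _ = _ * x
    ring
  rw [e]
  refine h.congr_deriv ?_
  change _ * s + _ * 1 = _
  ring

/-- A radial solution on `[0, z]` in dimension `N + 2`. -/
structure RadialSol (N : ℕ) (p z : ℝ) (u u' : ℝ → ℝ) : Prop where
  cont : ContinuousOn u (Icc 0 z)
  cont' : ContinuousOn u' (Icc 0 z)
  deriv : ∀ r ∈ Ioc 0 z, HasDerivAt u (u' r) r
  deriv' : ∀ r ∈ Ioc 0 z, HasDerivAt u' (-((N : ℝ) + 1) / r * u' r - f p (u r)) r
  zero' : u' 0 = 0

/-- A solution on `[0, z]` of the equation linearized at `u`. -/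
structure RadialVar (N : ℕ) (p z : ℝ) (u v v' : ℝ → ℝ) : Prop where
  cont : ContinuousOn v (Icc 0 z)
  cont' : ContinuousOn v' (Icc 0 z)
  deriv : ∀ r ∈ Ioc 0 z, HasDerivAt v (v' r) r
  deriv' : ∀ r ∈ Ioc 0 z, HasDerivAt v' (-((N : ℝ) + 1) / r * v' r - fder p (u r) * v r) r
  zero : v 0 = 1
  zero' : v' 0 = 0

noncomputable def powTerm (p : ℝ) (u : ℝ → ℝ) (r : ℝ) : ℝ := r ^ 2 * |u r| ^ (p - 1) * u r ^ 2

noncomputable def massTerm (u : ℝ → ℝ) (r : ℝ) : ℝ := r ^ 2 * u r ^ 2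

/-- The Pohozaev functional, up to the factor `r ^ N`. -/
noncomputable def pohozaev (N : ℕ) (p : ℝ) (u u' : ℝ → ℝ) (r : ℝ) : ℝ :=
  (r * u' r) ^ 2 + N * u r * (r * u' r) - r ^ 2 * u r ^ 2 + 2 / (p + 1) * powTerm p u r

namespace RadialSol

variable {N : ℕ} {p z : ℝ} {u u' : ℝ → ℝ}

theorem mono (h : RadialSol N p z u u') {y : ℝ} (hy : y ≤ z) : RadialSol N p y u u' where
  cont := h.cont.mono (Icc_subset_Icc_right hy)
  cont' := h.cont'.mono (Icc_subset_Icc_right hy)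
  deriv := fun r hr => h.deriv r ⟨hr.1, hr.2.trans hy⟩
  deriv' := fun r hr => h.deriv' r ⟨hr.1, hr.2.trans hy⟩
  zero' := h.zero'

theorem hasDerivAt_q (h : RadialSol N p z u u') {r : ℝ} (hr : r ∈ Ioc 0 z) :
    HasDerivAt (fun r => r * u' r)
      ((-N * (r * u' r) + r ^ 2 * u r - r ^ 2 * |u r| ^ (p - 1) * u r) / r) r := by
  have hr0 : r ≠ 0 := hr.1.ne'
  refine ((hasDerivAt_id r).mul (h.deriv' r hr)).congr_deriv ?_
  simp only [id, f]
  field_simp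
  ring

theorem hasDerivAt_powTerm (hp : 1 < p) (h : RadialSol N p z u u') {r : ℝ} (hr : r ∈ Ioc 0 z) :
    HasDerivAt (powTerm p u)
      ((2 * powTerm p u r + (p + 1) * (r ^ 2 * |u r| ^ (p - 1) * u r * (r * u' r))) / r) r := by
  have hr0 : r ≠ 0 := hr.1.ne'
  have e : powTerm p u = fun r => r ^ 2 * (|u r| ^ (p - 1) * u r ^ 2) := by
    funext r; unfold powTerm; ring
  have h1 := ((hasDerivAt_abs_rpow_mul_sq hp (u r)).comp r (h.deriv r hr))
  have h2 := (hasDerivAt_pow 2 r).mul h1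
  rw [e]
  refine h2.congr_deriv ?_
  simp only [Function.comp]
  field_simp
  norm_num
  ring

theorem hasDerivAt_massTerm (h : RadialSol N p z u u') {r : ℝ} (hr : r ∈ Ioc 0 z) :
    HasDerivAt (massTerm u) ((2 * massTerm u r + 2 * r ^ 2 * u r * (r * u' r)) / r) r := by
  have hr0 : r ≠ 0 := hr.1.ne'
  have h2 := (hasDerivAt_pow 2 r).mul ((h.deriv r hr).pow 2)
  refine h2.congr_deriv ?_
  simp only [massTerm, Pi.pow_apply]
  field_simp
  norm_num
  ring

theorem hasDerivAt_pohozaev (hp : 1 < p) (h : RadialSol N p z u u') {r : ℝ} (hr : r ∈ Ioc 0 z) :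
    HasDerivAt (pohozaev N p u u')
      ((-N * pohozaev N p u u' r + (4 - N * (p - 1)) / (p + 1) * powTerm p u r
        - 2 * massTerm u r) / r) r := by
  have hr0 : r ≠ 0 := hr.1.ne'
  have hp1 : p + 1 ≠ 0 := by linarith
  have hq := h.hasDerivAt_q hr
  have h1 := (((hq.pow 2).add (((h.deriv r hr).const_mul (N : ℝ)).mul hq)).sub
    (h.hasDerivAt_massTerm hr)).add ((h.hasDerivAt_powTerm hp hr).const_mul (2 / (p + 1)))
  refine h1.congr_deriv ?_
  simp only [massTerm, powTerm, pohozaev]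
  field_simp
  norm_num
  ring

theorem energy_pos (hp : 1 < p) (h : RadialSol N p z u u') (hz : u z = 0) (hz' : u' z ≠ 0)
    {r : ℝ} (hr : r ∈ Ioc 0 z) : 0 < u' r ^ 2 - u r ^ 2 + 2 / (p + 1) * (|u r| ^ (p - 1) * u r ^ 2) := by
  have hp1 : p + 1 ≠ 0 := by linarith
  have hd : ∀ x ∈ Icc r z, HasDerivAt
      (fun r => u' r ^ 2 - u r ^ 2 + 2 / (p + 1) * (|u r| ^ (p - 1) * u r ^ 2))
      (-2 * ((N : ℝ) + 1) / x * u' x ^ 2) x := by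
    intro x hx
    have hx' : x ∈ Ioc 0 z := ⟨hr.1.trans_le hx.1, hx.2⟩
    have hx0 : x ≠ 0 := hx'.1.ne'
    have h1 := (((h.deriv' x hx').pow 2).sub ((h.deriv x hx').pow 2)).add
      (((hasDerivAt_abs_rpow_mul_sq hp (u x)).comp x (h.deriv x hx')).const_mul (2 / (p + 1)))
    refine h1.congr_deriv ?_
    simp only [f]
    field_simp
    norm_num
    ring
  have hanti := antitoneOn_Icc_of_hasDerivAt (a := r) (b := z)
    (fun x hx => (hd x hx).continuousAt.continuousWithinAt)
    (fun x hx => hd x (Ioo_subset_Icc_self hx)) (fun x hx => by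
      have : 0 < x := hr.1.trans hx.1
      have : 0 ≤ 2 * ((N : ℝ) + 1) / x * u' x ^ 2 := by positivity
      have e : -2 * ((N : ℝ) + 1) / x * u' x ^ 2 = -(2 * ((N : ℝ) + 1) / x * u' x ^ 2) := by ring
      linarith)
  have := hanti (left_mem_Icc.2 hr.2) (right_mem_Icc.2 hr.2) hr.2
  simp only [hz] at this
  have h2 : 0 < u' z ^ 2 := by positivity
  refine lt_of_lt_of_le h2 (le_trans (le_of_eq ?_) this)
  simp

theorem pohozaev_sub_pos (hp : 1 < p) (h : RadialSol N p z u u') (hz : u z = 0) (hz' : u' z ≠ 0)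
    {r : ℝ} (hr : r ∈ Ioc 0 z) : 0 < pohozaev N p u u' r - N * u r * (r * u' r) := by
  have h1 := mul_pos (pow_pos hr.1 2) (h.energy_pos hp hz hz' hr)
  unfold pohozaev powTerm
  linarith

/-- The three-dimensional scaling energy is positive up to a zero. -/
theorem scaling_energy_pos (hp : 1 < p) (h : RadialSol 1 p z u u') (hz : u z = 0)
    (hz' : u' z ≠ 0) {r : ℝ} (hr : r ∈ Ioc 0 z) :
    0 < pohozaev 1 p u u' r + u r ^ 2 + u r * (r * u' r) := by
  have hp1 : p + 1 ≠ 0 := by linarith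
  have hd : ∀ x ∈ Icc r z, HasDerivAt
      (fun r => pohozaev 1 p u u' r + u r ^ 2 + u r * (r * u' r))
      (-2 * ((p - 1) / (p + 1) * (x * |u x| ^ (p - 1) * u x ^ 2))) x := by
    intro x hx
    have hx' : x ∈ Ioc 0 z := ⟨hr.1.trans_le hx.1, hx.2⟩
    have hx0 : x ≠ 0 := hx'.1.ne'
    have h1 := ((h.hasDerivAt_pohozaev hp hx').add ((h.deriv x hx').pow 2)).add
      ((h.deriv x hx').mul (h.hasDerivAt_q hx'))
    refine h1.congr_deriv ?_
    simp only [massTerm, powTerm, pohozaev]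
    field_simp
    norm_num
    ring
  have hanti := antitoneOn_Icc_of_hasDerivAt (a := r) (b := z)
    (fun x hx => (hd x hx).continuousAt.continuousWithinAt)
    (fun x hx => hd x (Ioo_subset_Icc_self hx)) (fun x hx => by
      have : 0 < x := hr.1.trans hx.1
      have : 0 ≤ (p - 1) / (p + 1) * (x * |u x| ^ (p - 1) * u x ^ 2) := by
        have : 0 ≤ (p - 1) / (p + 1) := div_nonneg (by linarith) (by linarith)
        positivity
      linarith)
  have := hanti (left_mem_Icc.2 hr.2) (right_mem_Icc.2 hr.2) hr.2
  simp only [hz] at this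
  have hz0 : 0 < z := hr.1.trans_le hr.2
  have h2 : 0 < (z * u' z) ^ 2 := by positivity
  refine lt_of_lt_of_le h2 (le_trans (le_of_eq ?_) this)
  simp [pohozaev, powTerm, hz]

theorem hasDerivAt_pow_mul_pohozaev (hp : 1 < p) (h : RadialSol N p z u u') {r : ℝ}
    (hr : r ∈ Ioc 0 z) :
    HasDerivAt (fun r => r ^ N * pohozaev N p u u' r)
      (r ^ (N + 1) * u r ^ 2 * ((4 - N * (p - 1)) / (p + 1) * |u r| ^ (p - 1) - 2)) r := by
  have hr0 : r ≠ 0 := hr.1.ne'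
  have hp1 : p + 1 ≠ 0 := by linarith
  refine ((hasDerivAt_pow N r).mul (h.hasDerivAt_pohozaev hp hr)).congr_deriv ?_
  have e : (N : ℝ) * r ^ (N - 1) = N * r ^ N / r := by
    rcases Nat.eq_zero_or_pos N with rfl | hN
    · simp
    · obtain ⟨k, rfl⟩ := Nat.exists_eq_succ_of_ne_zero hN.ne'
      rw [Nat.succ_sub_one, pow_succ]; field_simp
  rw [e, pow_succ]
  simp only [massTerm, powTerm]
  field_simp
  ring

theorem continuousOn_pohozaev (hp : 1 < p) (h : RadialSol N p z u u') :
    ContinuousOn (pohozaev N p u u') (Icc 0 z) := by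
  have h1 := h.cont
  have h2 := h.cont'
  have h3 : ContinuousOn (fun r => |u r| ^ (p - 1)) (Icc 0 z) :=
    (continuous_abs_rpow (sub_pos.2 hp)).comp_continuousOn h1
  unfold pohozaev powTerm
  fun_prop

theorem pohozaev_pos (hp : 1 < p) (h : RadialSol N p z u u') (hz : u z = 0) (hz' : u' z ≠ 0)
    (hNp : N * (p - 1) < 4) {r : ℝ} (hr : r ∈ Ioc 0 z) : 0 < pohozaev N p u u' r := by
  have hz0 : 0 < z := hr.1.trans_le hr.2
  have hm : 0 < (4 - N * (p - 1)) / (p + 1) := div_pos (by linarith) (by linarith)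
  have hPz : 0 < pohozaev N p u u' z := by
    have := h.pohozaev_sub_pos hp hz hz' (right_mem_Ioc.2 hz0)
    rw [hz] at this; linarith
  have hzero : ∀ x ∈ Ioc 0 z, u x = 0 → 0 < pohozaev N p u u' x := by
    intro x hx hux
    have := h.pohozaev_sub_pos hp hz hz' hx
    rw [hux] at this; linarith
  set G := fun r => r ^ N * pohozaev N p u u' r with hG
  have hGc : ContinuousOn G (Icc 0 z) :=
    (continuous_pow N).continuousOn.mul (h.continuousOn_pohozaev hp)
  have hG0 : G 0 = 0 := by simp [hG, pohozaev, powTerm]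
  by_contra hneg
  push Not at hneg
  have hGr : G r ≤ 0 := mul_nonpos_of_nonneg_of_nonpos (pow_nonneg hr.1.le N) hneg
  -- an interior minimum with nonpositive value
  obtain ⟨x, hx, hxmin, hGx⟩ : ∃ x ∈ Ioo 0 z, (∀ y ∈ Icc 0 z, G x ≤ G y) ∧ G x ≤ 0 := by
    have ne : ∀ x ∈ Icc 0 z, G x ≤ 0 → x ≠ z := by
      rintro x - hx1 rfl
      exact absurd hx1 (not_le.2 (mul_pos (pow_pos hz0 N) hPz))
    obtain ⟨x, hx, hxm⟩ := isCompact_Icc.exists_isMinOn ⟨0, left_mem_Icc.2 hz0.le⟩ hGc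
    have hxr : G x ≤ G r := hxm ⟨hr.1.le, hr.2⟩
    rcases hx.1.eq_or_lt with h0 | h0
    · refine ⟨r, ⟨hr.1, lt_of_le_of_ne hr.2 (ne r ⟨hr.1.le, hr.2⟩ hGr)⟩, fun y hy => ?_, hGr⟩
      rw [← h0, hG0] at hxr
      have h1 : G x ≤ G y := hxm hy
      rw [← h0, hG0] at h1
      linarith
    · exact ⟨x, ⟨h0, lt_of_le_of_ne hx.2 (ne x hx (hxr.trans hGr))⟩, fun y hy => hxm hy,
        hxr.trans hGr⟩
  have hxI : x ∈ Ioc 0 z := ⟨hx.1, hx.2.le⟩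
  have hPx : pohozaev N p u u' x ≤ 0 := by
    by_contra hc
    push Not at hc
    exact absurd hGx (not_le.2 (mul_pos (pow_pos hx.1 N) hc))
  have hux : u x ≠ 0 := fun h0 => absurd hPx (not_le.2 (hzero x hxI h0))
  have hd := h.hasDerivAt_pow_mul_pohozaev hp hxI
  have hloc : IsLocalMin G x := by
    filter_upwards [Icc_mem_nhds hx.1 hx.2] with y hy using hxmin y hy
  have hder := hloc.hasDerivAt_eq_zero hd
  have hme : (4 - N * (p - 1)) / (p + 1) * |u x| ^ (p - 1) = 2 := by
    have : x ^ (N + 1) * u x ^ 2 ≠ 0 := mul_ne_zero (pow_ne_zero _ hx.1.ne') (pow_ne_zero _ hux)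
    have := (mul_eq_zero.1 hder).resolve_left this
    linarith
  have hNuq : N * (x * (u x * u' x)) < 0 := by
    have := h.pohozaev_sub_pos hp hz hz' hxI
    linarith
  have huq : u x * u' x < 0 := by
    by_contra hc
    push Not at hc
    have : 0 ≤ N * (x * (u x * u' x)) := by have := hx.1.le; positivity
    linarith
  have hsq : HasDerivAt (fun y => u y ^ 2) (2 * (u x * u' x)) x := by
    refine ((h.deriv x hxI).pow 2).congr_deriv ?_
    norm_num; ring
  have hev : ∀ᶠ y in nhdsWithin x (Ioi x), u y ^ 2 < u x ^ 2 := by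
    have h1 := (hasDerivAt_iff_tendsto_slope.1 hsq).eventually_lt_const
      (by linarith : 2 * (u x * u' x) < 0)
    have h2 : nhdsWithin x (Ioi x) ≤ nhdsWithin x {x}ᶜ :=
      nhdsWithin_mono x fun y (hy : x < y) => hy.ne'
    filter_upwards [h2 h1, self_mem_nhdsWithin] with y hy hy2
    have hyx : 0 < y - x := sub_pos.2 hy2
    rw [slope_def_field, div_lt_iff₀ hyx] at hy
    linarith
  have hev2 : ∀ᶠ y in nhdsWithin x (Ioi x), u y ≠ 0 :=
    nhdsWithin_le_nhds ((h.deriv x hxI).continuousAt.eventually_ne hux)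
  have hev3 : ∀ᶠ y in nhdsWithin x (Ioi x), y < z := nhdsWithin_le_nhds (Iio_mem_nhds hx.2)
  obtain ⟨b, hb, hbI⟩ := mem_nhdsGT_iff_exists_Ioo_subset.1 (hev.and (hev2.and hev3))
  have hxb : x < b := hb
  set c := (x + b) / 2 with hc
  have hxc : x < c := by rw [hc]; linarith
  have hcb : c < b := by rw [hc]; linarith
  have hcz : c < z := (hbI ⟨hxc, hcb⟩).2.2
  have hanti : StrictAntiOn G (Icc x c) := by
    apply strictAntiOn_of_hasDerivWithinAt_neg (convex_Icc x c)
      (hGc.mono (Icc_subset_Icc hx.1.le hcz.le))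
      (f' := fun r => r ^ (N + 1) * u r ^ 2 *
        ((4 - N * (p - 1)) / (p + 1) * |u r| ^ (p - 1) - 2))
    · intro y hy
      rw [interior_Icc] at hy
      exact (h.hasDerivAt_pow_mul_pohozaev hp
        ⟨hx.1.trans hy.1, (hy.2.trans hcz).le⟩).hasDerivWithinAt
    · intro y hy
      rw [interior_Icc] at hy
      obtain ⟨h1, h2, -⟩ := hbI ⟨hy.1, hy.2.trans hcb⟩
      have hy0 : 0 < y := hx.1.trans hy.1
      apply mul_neg_of_pos_of_neg (by positivity)
      have : |u y| ^ (p - 1) < |u x| ^ (p - 1) :=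
        rpow_lt_rpow (abs_nonneg _) (sq_lt_sq.1 h1) (by linarith)
      nlinarith
  have h1 := hanti (left_mem_Icc.2 hxc.le) (right_mem_Icc.2 hxc.le) hxc
  exact absurd (hxmin c ⟨(hx.1.trans hxc).le, hcz.le⟩) (not_le.2 h1)

theorem hasDerivAt_pow_mul_deriv (h : RadialSol N p z u u') {r : ℝ} (hr : r ∈ Ioc 0 z) :
    HasDerivAt (fun r => r ^ (N + 1) * u' r) (-(r ^ (N + 1) * f p (u r))) r := by
  have hr0 : r ≠ 0 := hr.1.ne'
  refine ((hasDerivAt_pow (N + 1) r).mul (h.deriv' r hr)).congr_deriv ?_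
  rw [Nat.add_sub_cancel, pow_succ]
  field_simp
  push_cast
  ring

theorem deriv_nonpos (h : RadialSol N p z u u') (hf : ∀ r ∈ Ioo 0 z, 0 ≤ f p (u r)) {r : ℝ}
    (hr : r ∈ Icc 0 z) : u' r ≤ 0 := by
  rcases hr.1.eq_or_lt with h0 | h0
  · rw [← h0, h.zero']
  have hz0 : 0 < z := h0.trans_le hr.2
  have hanti := antitoneOn_Icc_of_hasDerivAt (a := 0) (b := z)
    ((continuous_pow (N + 1)).continuousOn.mul h.cont')
    (fun x hx => h.hasDerivAt_pow_mul_deriv ⟨hx.1, hx.2.le⟩) (fun x hx => by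
      have := mul_nonneg (pow_pos hx.1 (N + 1)).le (hf x hx)
      linarith)
  have h1 : r ^ (N + 1) * u' r ≤ 0 ^ (N + 1) * u' 0 := hanti (left_mem_Icc.2 hz0.le) hr h0.le
  rw [h.zero', mul_zero] at h1
  by_contra hc
  push Not at hc
  exact absurd h1 (not_le.2 (mul_pos (pow_pos h0 _) hc))

theorem antitoneOn_of_f_nonneg (h : RadialSol N p z u u') (hf : ∀ r ∈ Ioo 0 z, 0 ≤ f p (u r)) :
    AntitoneOn u (Icc 0 z) :=
  antitoneOn_Icc_of_hasDerivAt h.cont (fun x hx => h.deriv x ⟨hx.1, hx.2.le⟩)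
    fun _ hx => h.deriv_nonpos hf (Ioo_subset_Icc_self hx)

/-- A property of the value that is open at `u 0` holds on an initial interval. -/
theorem exists_initial (h : RadialSol N p z u u') (hz : 0 < z) {S : Set ℝ} (hS : S ∈ nhds (u 0)) :
    ∃ δ ∈ Ioc 0 z, ∀ r ∈ Icc 0 δ, u r ∈ S := by
  have h1 : ∀ᶠ r in nhdsWithin 0 (Icc 0 z), u r ∈ S :=
    (h.cont 0 (left_mem_Icc.2 hz.le)).eventually hS
  obtain ⟨ε, hε, hsub⟩ := Metric.mem_nhdsWithin_iff.1 h1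
  refine ⟨min (ε / 2) z, ⟨lt_min (by linarith) hz, min_le_right _ _⟩, fun r hr => hsub ⟨?_, ?_⟩⟩
  · rw [Metric.mem_ball, dist_zero_right, norm_eq_abs, abs_of_nonneg hr.1]
    have := hr.2.trans (min_le_left _ _)
    linarith
  · exact ⟨hr.1, hr.2.trans (min_le_right _ _)⟩

theorem initial_large (hp : 1 < p) (h : RadialSol N p z u u') (hN : 1 ≤ N) (hz0 : 0 < z)
    (hu0 : 0 < u 0) (hNp : N * (p - 1) < 4) (hP : ∀ r ∈ Ioc 0 z, 0 < pohozaev N p u u' r) :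
    2 < (4 - N * (p - 1)) / (p + 1) * |u 0| ^ (p - 1) := by
  by_contra hcon
  push Not at hcon
  set m := (4 - N * (p - 1)) / (p + 1) with hm
  have hm0 : 0 < m := div_pos (by linarith) (by linarith)
  have hm2 : m < 2 := by
    rw [hm, div_lt_iff₀ (by linarith)]
    have : (1 : ℝ) ≤ N := by exact_mod_cast hN
    nlinarith
  obtain ⟨δ, hδ, hle⟩ : ∃ δ ∈ Ioc 0 z, ∀ r ∈ Icc 0 δ, m * |u r| ^ (p - 1) ≤ 2 := by
    rcases hcon.lt_or_eq with hlt | heq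
    · have hc : Continuous fun s : ℝ => m * |s| ^ (p - 1) :=
        continuous_const.mul (continuous_abs_rpow (sub_pos.2 hp))
      obtain ⟨δ, hδ, hd⟩ := h.exists_initial hz0 (hc.continuousAt.eventually (Iio_mem_nhds hlt))
      exact ⟨δ, hδ, fun r hr => (hd r hr).le⟩
    · have hf0 : 0 < f p (u 0) := by
        have : 1 < |u 0| ^ (p - 1) := by
          by_contra hc
          push Not at hc
          nlinarith
        unfold f
        nlinarith
      have hS : {s | 0 < f p s ∧ 0 < s} ∈ nhds (u 0) :=
        ((continuous_f hp).continuousAt.eventually (Ioi_mem_nhds hf0)).and (Ioi_mem_nhds hu0)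
      obtain ⟨δ, hδ, hd⟩ := h.exists_initial hz0 hS
      refine ⟨δ, hδ, fun r hr => ?_⟩
      have h1 := (h.mono hδ.2).antitoneOn_of_f_nonneg
        (fun r hr => (hd r (Ioo_subset_Icc_self hr)).1.le)
        (left_mem_Icc.2 hδ.1.le) hr hr.1
      have h2 : |u r| ≤ |u 0| := by
        rw [abs_of_pos (hd r hr).2, abs_of_pos hu0]; exact h1
      rw [← heq]
      have := rpow_le_rpow (abs_nonneg _) h2 (by linarith : 0 ≤ p - 1)
      gcongr
  have hanti := antitoneOn_Icc_of_hasDerivAt (a := 0) (b := δ)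
    ((continuous_pow N).continuousOn.mul ((h.mono hδ.2).continuousOn_pohozaev hp))
    (fun x hx => (h.mono hδ.2).hasDerivAt_pow_mul_pohozaev hp ⟨hx.1, hx.2.le⟩) (fun x hx => by
      apply mul_nonpos_of_nonneg_of_nonpos
      · have := hx.1; positivity
      · have := hle x (Ioo_subset_Icc_self hx); linarith)
  have h1 : δ ^ N * pohozaev N p u u' δ ≤ 0 ^ N * pohozaev N p u u' 0 :=
    hanti (left_mem_Icc.2 hδ.1.le) (right_mem_Icc.2 hδ.1.le) hδ.1.le
  have h2 : 0 < δ ^ N * pohozaev N p u u' δ := mul_pos (pow_pos hδ.1 N) (hP δ hδ)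
  have h3 : pohozaev N p u u' 0 = 0 := by simp [pohozaev, powTerm]
  rw [h3, mul_zero] at h1
  linarith

/-- Near the origin `u` is positive and decreasing and `m |u|^(p-1) > 2`. -/
theorem initial_behaviour (hp : 1 < p) (h : RadialSol N p z u u') (hN : 1 ≤ N) (hz0 : 0 < z)
    (hu0 : 0 < u 0) (hNp : N * (p - 1) < 4) (hP : ∀ r ∈ Ioc 0 z, 0 < pohozaev N p u u' r) :
    ∃ δ ∈ Ioc 0 z, AntitoneOn u (Icc 0 δ) ∧ ∀ r ∈ Icc 0 δ, 0 < u r ∧ u' r ≤ 0 ∧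
      2 < (4 - N * (p - 1)) / (p + 1) * |u r| ^ (p - 1) := by
  have h0 := h.initial_large hp hN hz0 hu0 hNp hP
  set m := (4 - N * (p - 1)) / (p + 1) with hm
  have hm0 : 0 < m := div_pos (by linarith) (by linarith)
  have hm2 : m < 2 := by
    rw [hm, div_lt_iff₀ (by linarith)]
    have : (1 : ℝ) ≤ N := by exact_mod_cast hN
    nlinarith
  have hc : Continuous fun s : ℝ => m * |s| ^ (p - 1) :=
    continuous_const.mul (continuous_abs_rpow (sub_pos.2 hp))
  have hS : {s | 2 < m * |s| ^ (p - 1) ∧ 0 < s} ∈ nhds (u 0) :=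
    (hc.continuousAt.eventually (Ioi_mem_nhds h0)).and (Ioi_mem_nhds hu0)
  obtain ⟨δ, hδ, hd⟩ := h.exists_initial hz0 hS
  have hf : ∀ r ∈ Ioo 0 δ, 0 ≤ f p (u r) := by
    intro r hr
    obtain ⟨h1, h2⟩ := hd r (Ioo_subset_Icc_self hr)
    have : 1 < |u r| ^ (p - 1) := by
      by_contra hc
      push Not at hc
      nlinarith
    unfold f
    nlinarith
  exact ⟨δ, hδ, (h.mono hδ.2).antitoneOn_of_f_nonneg hf, fun r hr =>
    ⟨(hd r hr).2, (h.mono hδ.2).deriv_nonpos hf hr, (hd r hr).1⟩⟩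

end RadialSol

/-- The Wronskian of `r u'` and the variation, divided by `r ^ N`. -/
noncomputable def wronskA (u u' v v' : ℝ → ℝ) (r : ℝ) : ℝ := r * u' r * v r - u r * (r * v' r)

/-- The Wronskian of the scaling generator `r u' + 2 / (p - 1) u` and the variation. -/
noncomputable def wronskW (N : ℕ) (p : ℝ) (u u' v v' : ℝ → ℝ) (r : ℝ) : ℝ :=
  ((2 / (p - 1) - N) * (r * u' r) - r ^ 2 * f p (u r)) * v r
    - (r * u' r + 2 / (p - 1) * u r) * (r * v' r)

section Barrier

variable {N : ℕ} {p z : ℝ} {u u' v v' : ℝ → ℝ}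

theorem pow_sub_one_mul_self (N : ℕ) {r : ℝ} (hr0 : r ≠ 0) :
    (N : ℝ) * r ^ (N - 1) = N * r ^ N / r := by
  rcases Nat.eq_zero_or_pos N with rfl | hN
  · simp
  · obtain ⟨k, rfl⟩ := Nat.exists_eq_succ_of_ne_zero hN.ne'
    rw [Nat.succ_sub_one, pow_succ]; field_simp

theorem hasDerivAt_wronskA (h : RadialSol N p z u u') (hv : RadialVar N p z u v v')
    {r : ℝ} (hr : r ∈ Ioc 0 z) :
    HasDerivAt (fun r => r ^ N * wronskA u u' v v' r)
      (r ^ N * ((p - 1) * |u r| ^ (p - 1) * r * u r * v r)) r := by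
  have hr0 : r ≠ 0 := hr.1.ne'
  have d1 := h.deriv r hr
  have d2 := h.deriv' r hr
  have d3 := hv.deriv r hr
  have d4 := hv.deriv' r hr
  have hid := hasDerivAt_id r
  refine ((hasDerivAt_pow N r).mul (((hid.mul d2).mul d3).sub
    (d1.mul (hid.mul d4)))).congr_deriv ?_
  simp only [Pi.mul_apply, Pi.sub_apply, id, f, fder]
  rw [pow_sub_one_mul_self N hr0]
  field_simp
  ring

theorem hasDerivAt_wronskW (hp : 1 < p) (h : RadialSol N p z u u') (hv : RadialVar N p z u v v')
    {r : ℝ} (hr : r ∈ Ioc 0 z) :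
    HasDerivAt (fun r => r ^ N * wronskW N p u u' v v' r) (r ^ N * (2 * r * u r * v r)) r := by
  have hr0 : r ≠ 0 := hr.1.ne'
  have hp1 : p - 1 ≠ 0 := by linarith
  have d1 := h.deriv r hr
  have d2 := h.deriv' r hr
  have d3 := hv.deriv r hr
  have d4 := hv.deriv' r hr
  have d5 := (hasDerivAt_f hp (u r)).comp r d1
  have hid := hasDerivAt_id r
  refine ((hasDerivAt_pow N r).mul ((((((hid.mul d2).const_mul (2 / (p - 1) - (N : ℝ))).sub
    ((hasDerivAt_pow 2 r).mul d5)).mul d3)).sub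
    (((hid.mul d2).add (d1.const_mul (2 / (p - 1)))).mul (hid.mul d4)))).congr_deriv ?_
  simp only [Pi.mul_apply, Pi.sub_apply, Pi.add_apply, id, f, fder, Function.comp]
  rw [pow_sub_one_mul_self N hr0]
  field_simp
  norm_num
  ring

theorem mul_quotient_eq (hp : 1 < p) (r : ℝ) :
    v r * (pohozaev N p u u' r + (p - 1) / (p + 1) * powTerm p u r)
      = (r * u' r + 2 / (p - 1) * u r) * wronskA u u' v v' r - u r * wronskW N p u u' v v' r := by
  have hp1 : p - 1 ≠ 0 := by linarith
  have hp2 : p + 1 ≠ 0 := by linarith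
  unfold pohozaev powTerm wronskA wronskW f
  field_simp
  ring

/-- The Wronskians near the origin. -/
theorem initial_wronskians (hp : 1 < p) (h : RadialSol N p z u u') (hv : RadialVar N p z u v v')
    (hz : 0 < z) (hanti : AntitoneOn u (Icc 0 z)) (hu0 : ∀ r ∈ Icc 0 z, 0 < u r)
    (hv0 : ∀ r ∈ Icc 0 z, 0 < v r) :
    0 < z ^ N * wronskA u u' v v' z ∧
    (p - 1) * |u z| ^ (p - 1) * (z ^ N * wronskW N p u u' v v' z)
      ≤ 2 * (z ^ N * wronskA u u' v v' z) := by
  have hp1 : 0 < p - 1 := by linarith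
  have c1 := h.cont
  have c2 := h.cont'
  have c3 := hv.cont
  have c4 := hv.cont'
  have c5 : ContinuousOn (fun r => f p (u r)) (Icc 0 z) := (continuous_f hp).comp_continuousOn c1
  have cA : ContinuousOn (fun r => r ^ N * wronskA u u' v v' r) (Icc 0 z) := by
    unfold wronskA; fun_prop
  have cW : ContinuousOn (fun r => r ^ N * wronskW N p u u' v v' r) (Icc 0 z) := by
    unfold wronskW; fun_prop
  have zA : wronskA u u' v v' 0 = 0 := by simp [wronskA]
  have zW : wronskW N p u u' v v' 0 = 0 := by simp [wronskW]
  constructor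
  · have hmono : StrictMonoOn (fun r => r ^ N * wronskA u u' v v' r) (Icc 0 z) := by
      apply strictMonoOn_of_hasDerivWithinAt_pos (convex_Icc 0 z) cA
        (f' := fun r => r ^ N * ((p - 1) * |u r| ^ (p - 1) * r * u r * v r))
      · intro y hy
        rw [interior_Icc] at hy
        exact (hasDerivAt_wronskA h hv ⟨hy.1, hy.2.le⟩).hasDerivWithinAt
      · intro y hy
        rw [interior_Icc] at hy
        have h1 := hu0 y (Ioo_subset_Icc_self hy)
        have h2 := hv0 y (Ioo_subset_Icc_self hy)
        have h3 := hy.1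
        positivity
    have := hmono (left_mem_Icc.2 hz.le) (right_mem_Icc.2 hz.le) hz
    simpa only [zA, mul_zero] using this
  · have hA := antitoneOn_Icc_of_hasDerivAt (a := 0) (b := z)
      (G := fun r => (p - 1) * |u z| ^ (p - 1) * (r ^ N * wronskW N p u u' v v' r)
        - 2 * (r ^ N * wronskA u u' v v' r)) ((cW.const_mul _).sub (cA.const_mul _))
      (fun x hx => ((hasDerivAt_wronskW hp h hv ⟨hx.1, hx.2.le⟩).const_mul _).sub
        ((hasDerivAt_wronskA h hv ⟨hx.1, hx.2.le⟩).const_mul _)) (fun x hx => by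
        have hxI := Ioo_subset_Icc_self hx
        have h1 := hu0 x hxI
        have h2 := hv0 x hxI
        have h3 := hx.1
        have h4 : |u z| ^ (p - 1) ≤ |u x| ^ (p - 1) := by
          apply rpow_le_rpow (abs_nonneg _) _ hp1.le
          rw [abs_of_pos h1, abs_of_pos (hu0 z (right_mem_Icc.2 hz.le))]
          exact hanti hxI (right_mem_Icc.2 hz.le) hx.2.le
        have h5 : 0 ≤ 2 * (p - 1) * x ^ N * x * u x * v x := by positivity
        have := mul_nonneg h5 (sub_nonneg.2 h4)
        linarith)
    have := hA (left_mem_Icc.2 hz.le) (right_mem_Icc.2 hz.le) hz.le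
    simp only [zA, zW, mul_zero, sub_zero] at this
    linarith

/-- A barrier for the quotient of the two Wronskians determines the sign of the variation at a
zero of the solution. -/
theorem variation_sign_of_barrier (hp : 1 < p) (h : RadialSol N p z u u')
    (hv : RadialVar N p z u v v') {B dB : ℝ → ℝ} {δ : ℝ} (hδ : δ ∈ Ioc 0 z)
    (hB : ∀ r ∈ Icc δ z, HasDerivAt B (dB r / r) r)
    (hQ : ∀ r ∈ Icc δ z, 0 < pohozaev N p u u' r + (p - 1) / (p + 1) * powTerm p u r)
    (hG : ∀ r ∈ Icc δ z, 0 ≤ dB r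
      + r ^ 2 / (pohozaev N p u u' r + (p - 1) / (p + 1) * powTerm p u r)
        * ((p - 1) * |u r| ^ (p - 1) * B r - 2)
        * (u r * (r * u' r + 2 / (p - 1) * u r) - u r ^ 2 * B r))
    (hanti : AntitoneOn u (Icc 0 δ)) (hu0 : ∀ r ∈ Icc 0 δ, 0 < u r)
    (hv0 : ∀ r ∈ Icc 0 δ, 0 < v r) (hBδ : 2 < (p - 1) * |u δ| ^ (p - 1) * B δ)
    (hz : u z = 0) : 0 < u' z * v z := by
  have hp1 : 0 < p - 1 := by linarith
  have hz0 : 0 < z := hδ.1.trans_le hδ.2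
  have hsub : Icc δ z ⊆ Icc 0 z := Icc_subset_Icc_left hδ.1.le
  have hsub' : ∀ r ∈ Icc δ z, r ∈ Ioc 0 z := fun r hr => ⟨hδ.1.trans_le hr.1, hr.2⟩
  set A := fun r => r ^ N * wronskA u u' v v' r with hA
  set W := fun r => r ^ N * wronskW N p u u' v v' r with hW
  set Q := fun r => pohozaev N p u u' r + (p - 1) / (p + 1) * powTerm p u r with hQd
  set e := fun r => |u r| ^ (p - 1) with he
  set c1 := fun r => r / Q r * ((p - 1) * e r * B r - 2) * u r ^ 2 with hc1
  set c2 := fun r => (p - 1) * e r * (r / Q r)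
    * (u r * (r * u' r + 2 / (p - 1) * u r) - u r ^ 2 * B r) with hc2
  have k1 := h.cont.mono hsub
  have k2 := h.cont'.mono hsub
  have k3 : ContinuousOn e (Icc δ z) := (continuous_abs_rpow hp1).comp_continuousOn k1
  have k4 : ContinuousOn B (Icc δ z) := fun r hr => (hB r hr).continuousAt.continuousWithinAt
  have k5 : ContinuousOn Q (Icc δ z) := by
    have := (h.continuousOn_pohozaev hp).mono hsub
    have h2 : ContinuousOn (powTerm p u) (Icc δ z) := by
      exact ((continuous_pow 2).continuousOn.mul k3).mul (k1.pow 2)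
    fun_prop
  have k6 : ContinuousOn (fun r => r / Q r) (Icc δ z) :=
    continuousOn_id.div k5 fun r hr => (hQ r hr).ne'
  have kc1 : ContinuousOn c1 (Icc δ z) := by fun_prop
  have kc2 : ContinuousOn c2 (Icc δ z) := by fun_prop
  obtain ⟨K1, hK1⟩ := isCompact_Icc.exists_bound_of_continuousOn kc1
  obtain ⟨K2, hK2⟩ := isCompact_Icc.exists_bound_of_continuousOn kc2
  obtain ⟨hA0, hW0⟩ := initial_wronskians hp (h.mono hδ.2)
    (show RadialVar N p δ u v v' from
      { cont := hv.cont.mono (Icc_subset_Icc_right hδ.2)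
        cont' := hv.cont'.mono (Icc_subset_Icc_right hδ.2)
        deriv := fun r hr => hv.deriv r ⟨hr.1, hr.2.trans hδ.2⟩
        deriv' := fun r hr => hv.deriv' r ⟨hr.1, hr.2.trans hδ.2⟩
        zero := hv.zero
        zero' := hv.zero' }) hδ.1 hanti hu0 hv0
  have hH0 : 0 < B δ * A δ - W δ := by
    have hed : 0 < (p - 1) * |u δ| ^ (p - 1) := by
      have := abs_pos.2 (hu0 δ (right_mem_Icc.2 hδ.1.le)).ne'
      positivity
    have : 0 < (p - 1) * |u δ| ^ (p - 1) * (B δ * A δ - W δ) := by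
      have := mul_pos (sub_pos.2 hBδ) hA0
      simp only [hA, hW]
      linarith
    exact pos_of_mul_pos_right this hed.le
  have huv : ∀ r ∈ Icc δ z, r ^ N * (u r * v r)
      = ((u r * (r * u' r + 2 / (p - 1) * u r) - u r ^ 2 * B r) * A r
        + u r ^ 2 * (B r * A r - W r)) / Q r := by
    intro r hr
    rw [eq_div_iff (hQ r hr).ne']
    have := mul_quotient_eq (N := N) (u := u) (u' := u') (v := v) (v' := v') hp r
    simp only [hA, hW]
    linear_combination (r ^ N * u r) * this
  have hdA : ∀ r ∈ Icc δ z, HasDerivAt A (c2 r * A r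
      + (p - 1) * e r * (r / Q r) * u r ^ 2 * (B r * A r - W r)) r := by
    intro r hr
    refine (hasDerivAt_wronskA h hv (hsub' r hr)).congr_deriv ?_
    have := huv r hr
    simp only [hc2, he]
    linear_combination ((p - 1) * |u r| ^ (p - 1) * r) * this
  have hdH : ∀ r ∈ Icc δ z, HasDerivAt (fun r => B r * A r - W r)
      (c1 r * (B r * A r - W r) + (dB r + r ^ 2 / Q r * ((p - 1) * e r * B r - 2)
        * (u r * (r * u' r + 2 / (p - 1) * u r) - u r ^ 2 * B r)) / r * A r) r := by
    intro r hr
    have hr0 : r ≠ 0 := (hsub' r hr).1.ne'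
    refine (((hB r hr).mul (hasDerivAt_wronskA h hv (hsub' r hr))).sub
      (hasDerivAt_wronskW hp h hv (hsub' r hr))).congr_deriv ?_
    have := huv r hr
    have e1 : r ^ 2 / Q r / r = r / Q r := by field_simp
    have e2 : (dB r + r ^ 2 / Q r * ((p - 1) * e r * B r - 2)
        * (u r * (r * u' r + 2 / (p - 1) * u r) - u r ^ 2 * B r)) / r
        = dB r / r + r / Q r * ((p - 1) * e r * B r - 2)
        * (u r * (r * u' r + 2 / (p - 1) * u r) - u r ^ 2 * B r) := by
      rw [← e1]; ring
    rw [e2]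
    simp only [hc1, he]
    linear_combination (r * ((p - 1) * |u r| ^ (p - 1) * B r - 2)) * this
  have hfin := cooperative_pos (K := max K1 K2) hδ.2 hdA hdH hA0 hH0 (fun r hr ha hh => by
    have h1 := hK2 r hr
    rw [norm_eq_abs, abs_le] at h1
    have h2 := hQ r hr
    have h3 : 0 < r := (hsub' r hr).1
    have h4 : 0 ≤ (p - 1) * e r * (r / Q r) * u r ^ 2 * (B r * A r - W r) := by
      have : 0 ≤ e r := rpow_nonneg (abs_nonneg _) _
      have : 0 ≤ r / Q r := (div_pos h3 h2).le
      positivity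
    have h5 : -max K1 K2 ≤ c2 r := by linarith [le_max_right K1 K2]
    have := mul_le_mul_of_nonneg_right h5 ha
    linarith) (fun r hr ha hh => by
    have h1 := hK1 r hr
    rw [norm_eq_abs, abs_le] at h1
    have h3 : 0 < r := (hsub' r hr).1
    have h4 := mul_nonneg (div_nonneg (hG r hr) h3.le) ha
    have h5 : -max K1 K2 ≤ c1 r := by linarith [le_max_left K1 K2]
    have := mul_le_mul_of_nonneg_right h5 hh
    linarith)
  have h1 := hfin.1
  simp only [hA, wronskA, hz, zero_mul, sub_zero] at h1
  have h2 : 0 < z ^ N * z := by positivity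
  have h3 : 0 < z ^ N * z * (u' z * v z) := by linarith
  exact pos_of_mul_pos_right h3 h2.le

end Barrier

section Sign

variable {N : ℕ} {p z : ℝ} {u u' v v' : ℝ → ℝ}

theorem exists_pos_near_zero {g : ℝ → ℝ} (hz : 0 < z) (hg : ContinuousOn g (Icc 0 z)) (h0 : 0 < g 0) :
    ∃ δ ∈ Ioc 0 z, ∀ r ∈ Icc 0 δ, 0 < g r := by
  have h1 : ∀ᶠ r in nhdsWithin 0 (Icc 0 z), 0 < g r :=
    (hg 0 (left_mem_Icc.2 hz.le)).eventually (lt_mem_nhds h0)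
  obtain ⟨ε, hε, hsub⟩ := Metric.mem_nhdsWithin_iff.1 h1
  refine ⟨min (ε / 2) z, ⟨lt_min (by linarith) hz, min_le_right _ _⟩, fun r hr => hsub ⟨?_, ?_⟩⟩
  · rw [Metric.mem_ball, dist_zero_right, norm_eq_abs, abs_of_nonneg hr.1]
    have := hr.2.trans (min_le_left _ _)
    linarith
  · exact ⟨hr.1, hr.2.trans (min_le_right _ _)⟩

theorem variation_sign_low (hp : 1 < p) (h : RadialSol N p z u u') (hv : RadialVar N p z u v v')
    (hN : 1 ≤ N) (hNp : N * (p - 1) < 4) (hp3 : p ≤ 3) (hz0 : 0 < z) (hu0 : 0 < u 0) (hz : u z = 0)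
    (hz' : u' z ≠ 0) : 0 < u' z * v z := by
  have hP : ∀ r ∈ Ioc 0 z, 0 < pohozaev N p u u' r := fun r hr => h.pohozaev_pos hp hz hz' hNp hr
  obtain ⟨δ₁, hδ₁, hanti, hi⟩ := h.initial_behaviour hp hN hz0 hu0 hNp hP
  obtain ⟨δ₂, hδ₂, hvp⟩ := exists_pos_near_zero hz0 hv.cont (by rw [hv.zero]; norm_num)
  set δ := min δ₁ δ₂ with hδd
  have hδ : δ ∈ Ioc 0 z := ⟨lt_min hδ₁.1 hδ₂.1, (min_le_left _ _).trans hδ₁.2⟩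
  have hs1 : Icc 0 δ ⊆ Icc 0 δ₁ := Icc_subset_Icc_right (min_le_left _ _)
  have hs2 : Icc 0 δ ⊆ Icc 0 δ₂ := Icc_subset_Icc_right (min_le_right _ _)
  have hp1 : 0 < p - 1 := by linarith
  have hp2 : 0 < p + 1 := by linarith
  have hps : p + 1 = (p - 1) + 2 := by ring
  set m := (4 - N * (p - 1)) / (p + 1) with hm
  set μ := m / (p - 1) with hμ
  have hX0 : ∀ r, 0 ≤ powTerm p u r := fun r => by
    have : 0 ≤ |u r| ^ (p - 1) := rpow_nonneg (abs_nonneg _) _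
    unfold powTerm; positivity
  have hQ : ∀ r ∈ Icc δ z, 0 < pohozaev N p u u' r + (p - 1) / (p + 1) * powTerm p u r := by
    intro r hr
    have h1 := hP r ⟨hδ.1.trans_le hr.1, hr.2⟩
    have h2 := hX0 r
    positivity
  refine variation_sign_of_barrier hp h hv hδ
    (B := fun r => (massTerm u r + μ * pohozaev N p u u' r)
      / (pohozaev N p u u' r + (p - 1) / (p + 1) * powTerm p u r))
    (dB := fun r => (((2 * massTerm u r + 2 * r ^ 2 * u r * (r * u' r))
        + μ * (-N * pohozaev N p u u' r + m * powTerm p u r - 2 * massTerm u r))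
        * (pohozaev N p u u' r + (p - 1) / (p + 1) * powTerm p u r)
      - (massTerm u r + μ * pohozaev N p u u' r)
        * ((-N * pohozaev N p u u' r + m * powTerm p u r - 2 * massTerm u r)
          + (p - 1) / (p + 1) * (2 * powTerm p u r
            + (p + 1) * (r ^ 2 * |u r| ^ (p - 1) * u r * (r * u' r)))))
      / (pohozaev N p u u' r + (p - 1) / (p + 1) * powTerm p u r) ^ 2) ?_ hQ ?_
    (hanti.mono hs1) (fun r hr => (hi r (hs1 hr)).1) (fun r hr => hvp r (hs2 hr)) ?_ hz
  · intro r hr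
    have hr' : r ∈ Ioc 0 z := ⟨hδ.1.trans_le hr.1, hr.2⟩
    have hr0 : r ≠ 0 := hr'.1.ne'
    have d1 := h.hasDerivAt_massTerm hr'
    have d2 := h.hasDerivAt_pohozaev hp hr'
    have d3 := h.hasDerivAt_powTerm hp hr'
    refine ((d1.add (d2.const_mul μ)).div (d2.add (d3.const_mul ((p - 1) / (p + 1))))
      (hQ r hr).ne').congr_deriv ?_
    simp only [Pi.add_apply]
    rw [← hm]
    generalize pohozaev N p u u' r = P
    generalize powTerm p u r = X
    generalize massTerm u r = Z
    rw [div_right_comm]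
    congr 1
    field_simp
  · intro r hr
    have hr' : r ∈ Ioc 0 z := ⟨hδ.1.trans_le hr.1, hr.2⟩
    have := barrier_low_nonneg (N := N) (s := p - 1) (μ := μ) (m := m) (u := u r) (q := r * u' r)
      (ρ := r ^ 2) (e := |u r| ^ (p - 1)) hp1 (by linarith) (by exact_mod_cast hN) hNp
      (by rw [hm, hps]) hμ (pow_pos hr'.1 2) (rpow_nonneg (abs_nonneg _) _)
      (X := powTerm p u r) (Z := massTerm u r) (P := pohozaev N p u u' r) rfl rfl
      (by rw [← hps]) rfl rfl rfl (hP r hr')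
    rw [← hps] at this
    exact this
  · have hδm : δ ∈ Icc δ z := left_mem_Icc.2 hδ.2
    have hi' := hi δ (hs1 (right_mem_Icc.2 hδ.1.le))
    have h1 := hQ δ hδm
    have h2 := hP δ hδ
    have h3 := hX0 δ
    have h4 : |u δ| ^ (p - 1) * massTerm u δ = powTerm p u δ := by unfold massTerm powTerm; ring
    have h5 : (p - 1) * μ = m := by rw [hμ]; field_simp
    have h6 : (p - 1) * |u δ| ^ (p - 1) * ((massTerm u δ + μ * pohozaev N p u u' δ)
        / (pohozaev N p u u' δ + (p - 1) / (p + 1) * powTerm p u δ))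
        = ((p - 1) * powTerm p u δ + (m * |u δ| ^ (p - 1)) * pohozaev N p u u' δ)
        / (pohozaev N p u u' δ + (p - 1) / (p + 1) * powTerm p u δ) := by
      rw [← h4, ← h5]; ring
    rw [h6, lt_div_iff₀ h1]
    have h7 := mul_lt_mul_of_pos_right hi'.2.2 h2
    have h8 : 2 * ((p - 1) / (p + 1)) ≤ p - 1 := by
      rw [← mul_div_assoc, div_le_iff₀ hp2]; nlinarith
    have h9 := mul_le_mul_of_nonneg_right h8 h3
    linarith

theorem variation_sign_high (hp : 1 < p) (h : RadialSol 1 p z u u') (hv : RadialVar 1 p z u v v')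
    (hNp : p - 1 < 4) (hp3 : 3 ≤ p) (hz0 : 0 < z) (hu0 : 0 < u 0) (hz : u z = 0)
    (hz' : u' z ≠ 0) : 0 < u' z * v z := by
  have hNp' : ((1 : ℕ) : ℝ) * (p - 1) < 4 := by rw [Nat.cast_one, one_mul]; exact hNp
  have hP : ∀ r ∈ Ioc 0 z, 0 < pohozaev 1 p u u' r := fun r hr => h.pohozaev_pos hp hz hz' hNp' hr
  have hE : ∀ r ∈ Ioc 0 z, 0 < pohozaev 1 p u u' r + u r ^ 2 + u r * (r * u' r) :=
    fun r hr => h.scaling_energy_pos hp hz hz' hr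
  have hH : ∀ r ∈ Ioc 0 z, 0 < pohozaev 1 p u u' r - u r * (r * u' r) := fun r hr => by
    have := h.pohozaev_sub_pos hp hz hz' hr
    rwa [Nat.cast_one, one_mul] at this
  obtain ⟨δ₁, hδ₁, hanti, hi⟩ := h.initial_behaviour hp le_rfl hz0 hu0 hNp' hP
  obtain ⟨δ₂, hδ₂, hvp⟩ := exists_pos_near_zero hz0 hv.cont (by rw [hv.zero]; norm_num)
  obtain ⟨δ₃, hδ₃, hup⟩ := exists_pos_near_zero hz0 (h.cont.add (continuousOn_id.mul h.cont'))
    (by simpa using hu0)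
  set δ := min δ₁ (min δ₂ δ₃) with hδd
  have hδ : δ ∈ Ioc 0 z := ⟨lt_min hδ₁.1 (lt_min hδ₂.1 hδ₃.1), (min_le_left _ _).trans hδ₁.2⟩
  have hs1 : Icc 0 δ ⊆ Icc 0 δ₁ := Icc_subset_Icc_right (min_le_left _ _)
  have hs2 : Icc 0 δ ⊆ Icc 0 δ₂ :=
    Icc_subset_Icc_right ((min_le_right _ _).trans (min_le_left _ _))
  have hs3 : Icc 0 δ ⊆ Icc 0 δ₃ :=
    Icc_subset_Icc_right ((min_le_right _ _).trans (min_le_right _ _))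
  have hp1 : 0 < p - 1 := by linarith
  have hp2 : 0 < p + 1 := by linarith
  obtain ⟨k, hk⟩ : ∃ k, k = 2 / (p - 1) - 1 / 2 := ⟨_, rfl⟩
  have hk1 : (p - 1) * (1 + 2 * k) = 4 := by rw [hk]; field_simp; ring
  have hk0 : 0 ≤ k := by nlinarith
  have hk2 : k ≤ 1 / 2 := by nlinarith
  obtain ⟨c, hc⟩ : ∃ c, c = 3 / 2 + k := ⟨_, rfl⟩
  have hc0 : 0 < c := by linarith
  have hck : (p + 1) * (1 + 2 * k) = 4 * c := by linarith
  have hk3 : 1 + 2 * k ≠ 0 := by linarith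
  have r1 : (p - 1) / (p + 1) = 1 / c := by
    rw [div_eq_div_iff hp2.ne' hc0.ne']
    apply mul_right_cancel₀ hk3; linear_combination c * hk1 - hck
  have r2 : 2 / (p - 1) = 1 / 2 + k := by rw [hk]; ring
  have r3 : 2 / (p + 1) = (1 + 2 * k) / (2 * c) := by
    rw [div_eq_div_iff hp2.ne' (by positivity)]; linarith
  have r4 : (4 - ((1 : ℕ) : ℝ) * (p - 1)) / (p + 1) = 2 * k / c := by
    rw [div_eq_div_iff hp2.ne' hc0.ne', Nat.cast_one]
    apply mul_right_cancel₀ hk3; linear_combination -c * hk1 - 2 * k * hck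
  have hX0 : ∀ r, 0 ≤ powTerm p u r := fun r => by
    have : 0 ≤ |u r| ^ (p - 1) := rpow_nonneg (abs_nonneg _) _
    unfold powTerm; positivity
  set P := pohozaev 1 p u u' with hPd
  set X := powTerm p u with hXd
  set Z := massTerm u with hZd
  set Q := fun r => P r + X r / c with hQd
  set D := fun r => Z r + c * P r + c * u r ^ 2 with hDd
  set Y := fun r => u r ^ 2 / 2 + u r * (r * u' r) - k * u r ^ 2 with hYd
  set dX := fun r => 2 * X r + ((p - 1) + 2) * (r ^ 2 * |u r| ^ (p - 1) * u r * (r * u' r)) with hdX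
  set dZ := fun r => 2 * Z r + 2 * r ^ 2 * u r * (r * u' r) with hdZ
  set dP := fun r => -P r + 2 * k / c * X r - 2 * Z r with hdP
  set dQ := fun r => dP r + dX r / c with hdQ
  set dD := fun r => dZ r + c * dP r + c * (2 * u r * (r * u' r)) with hdD
  set dY := fun r => u r * (r * u' r) + (r * u' r) ^ 2 + u r * (-(r * u' r) + r ^ 2 * u r
    - r ^ 2 * |u r| ^ (p - 1) * u r) - k * (2 * u r * (r * u' r)) with hdY
  have hPe : ∀ r, P r = (r * u' r) ^ 2 + u r * (r * u' r) - r ^ 2 * u r ^ 2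
      + (1 + 2 * k) / (2 * c) * X r := by
    intro r
    rw [hPd, pohozaev, r3, Nat.cast_one, one_mul]
  have hmem : ∀ r ∈ Icc δ z, r ∈ Ioc 0 z := fun r hr => ⟨hδ.1.trans_le hr.1, hr.2⟩
  have hden : ∀ r ∈ Icc δ z, 0 < Q r * D r + Y r * Z r := fun r hr =>
    tail_den_pos (u := u r) (q := r * u' r) (ρ := r ^ 2) (e := |u r| ^ (p - 1)) hk0 hk2
      (pow_pos (hmem r hr).1 2) (rpow_nonneg (abs_nonneg _) _) hc rfl rfl (hPe r) rfl rfl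
      (hP r (hmem r hr)) (hE r (hmem r hr)).le (hH r (hmem r hr)).le
  have hQe : ∀ r, pohozaev 1 p u u' r + (p - 1) / (p + 1) * powTerm p u r = Q r := fun r => by
    rw [r1, hQd, ← hPd, ← hXd]; ring
  have hQ : ∀ r ∈ Icc δ z, 0 < Q r := fun r hr => by
    have h1 := hP r (hmem r hr)
    have h2 := div_nonneg (hX0 r) hc0.le
    exact add_pos_of_pos_of_nonneg h1 h2
  refine variation_sign_of_barrier hp h hv hδ
    (B := fun r => Z r * D r / (Q r * D r + Y r * Z r))
    (dB := fun r => ((dZ r * D r + Z r * dD r) * (Q r * D r + Y r * Z r)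
      - Z r * D r * (dQ r * D r + Q r * dD r + (dY r * Z r + Y r * dZ r)))
        / (Q r * D r + Y r * Z r) ^ 2) ?_ (fun r hr => by rw [hQe]; exact hQ r hr) ?_
    (hanti.mono hs1) (fun r hr => (hi r (hs1 hr)).1) (fun r hr => hvp r (hs2 hr)) ?_ hz
  · intro r hr
    have hr' := hmem r hr
    have hr0 : r ≠ 0 := hr'.1.ne'
    have d1 : HasDerivAt Z (dZ r / r) r := h.hasDerivAt_massTerm hr'
    have d2 : HasDerivAt P (dP r / r) r := (h.hasDerivAt_pohozaev hp hr').congr_deriv (by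
      rw [r4, Nat.cast_one, neg_one_mul])
    have d3 : HasDerivAt X (dX r / r) r := (h.hasDerivAt_powTerm hp hr').congr_deriv (by
      simp only [hdX, hXd]; ring)
    have d4 : HasDerivAt Q (dQ r / r) r := (d2.add (d3.div_const c)).congr_deriv (by
      simp only [hdQ]; ring)
    have d0 := h.deriv r hr'
    have d5 : HasDerivAt D (dD r / r) r :=
      ((d1.add (d2.const_mul c)).add ((d0.pow 2).const_mul c)).congr_deriv (by
        simp only [hdD]; field_simp; norm_num; ring)
    have d6 : HasDerivAt Y (dY r / r) r :=
      ((((d0.pow 2).div_const 2).add (d0.mul (h.hasDerivAt_q hr'))).sub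
        ((d0.pow 2).const_mul k)).congr_deriv (by
        simp only [hdY]; field_simp; norm_num; ring)
    refine ((d1.mul d5).div ((d4.mul d5).add (d6.mul d1)) (hden r hr).ne').congr_deriv ?_
    simp only [Pi.add_apply, Pi.mul_apply]
    rw [div_right_comm]
    congr 1
    field_simp
  · intro r hr
    rw [hQe, r2]
    exact barrier_tail_nonneg (h := k) (s := p - 1) (u := u r) (q := r * u' r)
      (ρ := r ^ 2) (e := |u r| ^ (p - 1)) hk0 hk2 hk1
      (pow_pos (hmem r hr).1 2) (rpow_nonneg (abs_nonneg _) _) hc rfl rfl (hPe r) rfl rfl rfl rfl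
      rfl rfl rfl rfl rfl rfl
      (hP r (hmem r hr)) (hE r (hmem r hr)).le (hH r (hmem r hr)).le
  · have hδm : δ ∈ Icc δ z := left_mem_Icc.2 hδ.2
    have hi' := hi δ (hs1 (right_mem_Icc.2 hδ.1.le))
    have hu := hi'.1
    have hq : δ * u' δ ≤ 0 := mul_nonpos_of_nonneg_of_nonpos hδ.1.le hi'.2.1
    have huq : 0 < u δ + δ * u' δ := hup δ (hs3 (right_mem_Icc.2 hδ.1.le))
    have hPp := hP δ hδ
    have hXn := hX0 δ
    have hZp : 0 < Z δ := mul_pos (pow_pos hδ.1 2) (pow_pos hu 2)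
    have h4 : |u δ| ^ (p - 1) * Z δ = X δ := by simp only [hZd, hXd, massTerm, powTerm]; ring
    have h6 : (p - 1) * |u δ| ^ (p - 1) * (Z δ * D δ / (Q δ * D δ + Y δ * Z δ))
        = (p - 1) * X δ * D δ / (Q δ * D δ + Y δ * Z δ) := by
      rw [← h4]; ring
    rw [h6, lt_div_iff₀ (hden δ hδm)]
    have hQ2 : 2 * Q δ = 2 * (δ * u' δ) * (u δ + δ * u' δ) - 2 * Z δ + 2 * X δ := by
      have : (1 + 2 * k) / (2 * c) * X δ + X δ / c = X δ := by
        rw [hc]; field_simp; ring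
      have hZe : Z δ = δ ^ 2 * u δ ^ 2 := rfl
      simp only [hQd]
      rw [hPe δ, hZe]
      linear_combination 2 * this
    have hDp : 0 < D δ := by simp only [hDd]; positivity
    have hYD : Y δ < D δ := by
      simp only [hDd, hYd]
      have := mul_nonpos_of_nonneg_of_nonpos hu.le hq
      have h1 := pow_pos hu 2
      have h2 : 0 < c * P δ := mul_pos hc0 hPp
      rw [hc] at h2 ⊢
      nlinarith
    have t1 := mul_nonneg (mul_nonneg (by linarith : 0 ≤ p - 1 - 2) hXn) hDp.le
    have t2 := mul_nonneg (mul_nonneg (neg_nonneg.2 hq) huq.le) hDp.le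
    have t3 := mul_pos hZp (sub_pos.2 hYD)
    have t4 : 2 * (Q δ * D δ) = (2 * (δ * u' δ) * (u δ + δ * u' δ) - 2 * Z δ + 2 * X δ) * D δ := by
      rw [← hQ2]; ring
    linarith

/-- At a zero of a radial solution its derivative and the variation have the same sign. -/
theorem variation_sign (hp : 1 < p) (h : RadialSol N p z u u') (hv : RadialVar N p z u v v')
    (hN : 1 ≤ N) (hNp : N * (p - 1) < 4) (hz0 : 0 < z) (hu0 : 0 < u 0) (hz : u z = 0)
    (hz' : u' z ≠ 0) : 0 < u' z * v z := by
  rcases le_total p 3 with hp3 | hp3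
  · exact variation_sign_low hp h hv hN hNp hp3 hz0 hu0 hz hz'
  · obtain rfl : N = 1 := by
      by_contra hne
      have : (2 : ℝ) ≤ N := by
        have : 2 ≤ N := by omega
        exact_mod_cast this
      nlinarith
    refine variation_sign_high hp h hv ?_ hp3 hz0 hu0 hz hz'
    rwa [Nat.cast_one, one_mul] at hNp

end Sign

section Existence

/-- The weighted mean `r ^ (-(N + 1)) ∫₀ʳ s ^ (N + 1) g s ds`, the negative of the derivative of the
radial solution of `-Δ u = g` in dimension `N + 2`. -/
noncomputable def radialMean (N : ℕ) (g : ℝ → ℝ) (r : ℝ) : ℝ :=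
  (∫ s in (0 : ℝ)..r, s ^ (N + 1) * g s) / r ^ (N + 1)

theorem radialMean_zero (N : ℕ) (g : ℝ → ℝ) : radialMean N g 0 = 0 := by
  simp [radialMean]

theorem radialMean_sub (N : ℕ) {g₁ g₂ : ℝ → ℝ} (h₁ : Continuous g₁) (h₂ : Continuous g₂) (r : ℝ) :
    radialMean N (fun s => g₁ s - g₂ s) r = radialMean N g₁ r - radialMean N g₂ r := by
  unfold radialMean
  rw [← sub_div, ← intervalIntegral.integral_sub]
  · simp only [mul_sub]
  · exact (by fun_prop : Continuous fun s => s ^ (N + 1) * g₁ s).intervalIntegrable _ _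
  · exact (by fun_prop : Continuous fun s => s ^ (N + 1) * g₂ s).intervalIntegrable _ _

theorem abs_radialMean_le (N : ℕ) {g : ℝ → ℝ} {r C : ℝ} (hg : ∀ s ∈ uIcc 0 r, |g s| ≤ C) :
    |radialMean N g r| ≤ |r| * C := by
  rcases eq_or_ne r 0 with rfl | hr
  · simp [radialMean]
  have hr' : 0 < |r| := abs_pos.2 hr
  unfold radialMean
  rw [abs_div, abs_pow, div_le_iff₀ (pow_pos hr' _)]
  have := intervalIntegral.norm_integral_le_of_norm_le_const (a := 0) (b := r)
    (f := fun s => s ^ (N + 1) * g s) (C := |r| ^ (N + 1) * C) (fun s hs => by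
      have hs' : s ∈ uIcc 0 r := uIoc_subset_uIcc hs
      rw [norm_eq_abs, abs_mul, abs_pow]
      have h1 : |s| ≤ |r| := by simpa using abs_sub_left_of_mem_uIcc hs'
      have h2 := hg s hs'
      gcongr)
  rw [norm_eq_abs, sub_zero] at this
  linarith

theorem hasDerivAt_radialMean (N : ℕ) {g : ℝ → ℝ} (hg : Continuous g) {r : ℝ} (hr : r ≠ 0) :
    HasDerivAt (radialMean N g) (g r - ((N : ℝ) + 1) / r * radialMean N g r) r := by
  have hc : Continuous fun s => s ^ (N + 1) * g s := by fun_prop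
  have h1 : HasDerivAt (fun r => ∫ s in (0 : ℝ)..r, s ^ (N + 1) * g s) (r ^ (N + 1) * g r) r :=
    intervalIntegral.integral_hasDerivAt_right (hc.intervalIntegrable _ _)
      (hc.stronglyMeasurableAtFilter _ _) hc.continuousAt
  refine (h1.div (hasDerivAt_pow (N + 1) r) (pow_ne_zero _ hr)).congr_deriv ?_
  unfold radialMean
  rw [Nat.add_sub_cancel]
  push_cast
  field_simp
  ring

theorem continuous_radialMean (N : ℕ) {g : ℝ → ℝ} (hg : Continuous g) :
    Continuous (radialMean N g) := by
  rw [continuous_iff_continuousAt]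
  intro r
  rcases eq_or_ne r 0 with rfl | hr
  · obtain ⟨C, hC⟩ := (isCompact_Icc (a := (-1 : ℝ)) (b := 1)).exists_bound_of_continuousOn
      hg.continuousOn
    rw [ContinuousAt, radialMean_zero]
    have h0 : Tendsto (fun r : ℝ => |r| * C) (nhds 0) (nhds 0) := by
      have : Continuous fun r : ℝ => |r| * C := by fun_prop
      simpa using this.tendsto 0
    refine squeeze_zero_norm' ?_ h0
    filter_upwards [Icc_mem_nhds (show (-1 : ℝ) < 0 by norm_num) zero_lt_one] with r hr
    exact abs_radialMean_le N fun s hs => hC s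
      ((uIcc_subset_Icc (by norm_num : (0 : ℝ) ∈ Icc (-1) 1) hr) hs)
  · exact (hasDerivAt_radialMean N hg hr).continuousAt

/-- Global solvability of the radial initial value problem for a Lipschitz nonlinearity. -/
theorem exists_radial_solution (N : ℕ) {R L : ℝ} (hR : 0 ≤ R) {G : ℝ → ℝ → ℝ}
    (hG : Continuous fun x : ℝ × ℝ => G x.1 x.2) (hL0 : 0 ≤ L)
    (hL : ∀ s a b, |G s a - G s b| ≤ L * |a - b|) (β : ℝ) :
    ∃ u u' : ℝ → ℝ, Continuous u ∧ Continuous u' ∧ u 0 = β ∧ u' 0 = 0 ∧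
      ∀ r ∈ Ioc 0 R, HasDerivAt u (u' r) r ∧
        HasDerivAt u' (-((N : ℝ) + 1) / r * u' r - G r (u r)) r := by
  set k := 2 * R * L + 1 with hk
  have hk0 : 0 < k := by positivity
  let g : C(Icc 0 R, ℝ) → ℝ → ℝ := fun y s => G s (exp (k * s) * IccExtend hR y s)
  have hg : ∀ y, Continuous (g y) := fun y =>
    hG.comp (continuous_id.prodMk ((by fun_prop : Continuous fun s : ℝ => exp (k * s)).mul
      y.continuous.Icc_extend'))
  have hJ : ∀ y, Continuous (radialMean N (g y)) := fun y => continuous_radialMean N (hg y)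
  have hI : ∀ y r, HasDerivAt (fun r => ∫ τ in (0 : ℝ)..r, radialMean N (g y) τ)
      (radialMean N (g y) r) r := fun y r =>
    intervalIntegral.integral_hasDerivAt_right ((hJ y).intervalIntegrable _ _)
      ((hJ y).stronglyMeasurableAtFilter _ _) (hJ y).continuousAt
  have hIc : ∀ y, Continuous fun r => ∫ τ in (0 : ℝ)..r, radialMean N (g y) τ := fun y =>
    continuous_iff_continuousAt.2 fun r => (hI y r).continuousAt
  let T : C(Icc 0 R, ℝ) → C(Icc 0 R, ℝ) := fun y =>
    ⟨fun r => exp (-(k * r)) * (β - ∫ τ in (0 : ℝ)..r, radialMean N (g y) τ), by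
      have := hIc y
      fun_prop⟩
  have hT : ∀ y r, T y r = exp (-(k * r)) * (β - ∫ τ in (0 : ℝ)..r, radialMean N (g y) τ) :=
    fun _ _ => rfl
  have hcontr : ContractingWith (1 / 2 : NNReal) T := by
    refine ⟨by rw [← NNReal.coe_lt_coe]; norm_num, LipschitzWith.of_dist_le_mul fun y₁ y₂ => ?_⟩
    rw [ContinuousMap.dist_le (by positivity)]
    intro r
    set d := dist y₁ y₂ with hd
    have hd0 : 0 ≤ d := dist_nonneg
    have hr0 : (0 : ℝ) ≤ r := r.2.1
    have hJb : ∀ τ ∈ Icc (0 : ℝ) r, |radialMean N (g y₂) τ - radialMean N (g y₁) τ|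
        ≤ R * L * d * exp (k * τ) := by
      intro τ hτ
      rw [← radialMean_sub N (hg y₂) (hg y₁)]
      refine (abs_radialMean_le N (C := L * (exp (k * τ) * d)) fun s hs => ?_).trans ?_
      · rw [uIcc_of_le hτ.1] at hs
        refine (hL _ _ _).trans ?_
        rw [← mul_sub, abs_mul, abs_of_pos (exp_pos _), abs_sub_comm]
        have h1 : |IccExtend hR y₁ s - IccExtend hR y₂ s| ≤ d :=
          ContinuousMap.dist_apply_le_dist (f := y₁) (g := y₂) (projIcc 0 R hR s)
        have h2 : exp (k * s) ≤ exp (k * τ) := exp_le_exp.2 (by nlinarith [hs.2])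
        gcongr
      · rw [abs_of_nonneg hτ.1]
        have h3 : τ ≤ R := hτ.2.trans r.2.2
        have h4 : 0 ≤ L * (exp (k * τ) * d) := by positivity
        nlinarith
    have h1 : dist (T y₁ r) (T y₂ r) = exp (-(k * r)) *
        |∫ τ in (0 : ℝ)..r, (radialMean N (g y₂) τ - radialMean N (g y₁) τ)| := by
      rw [dist_eq, hT, hT, ← mul_sub, abs_mul, abs_of_pos (exp_pos _),
        intervalIntegral.integral_sub ((hJ _).intervalIntegrable _ _)
          ((hJ _).intervalIntegrable _ _)]
      congr 2
      ring
    have h2 : |∫ τ in (0 : ℝ)..r, (radialMean N (g y₂) τ - radialMean N (g y₁) τ)|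
        ≤ ∫ τ in (0 : ℝ)..r, R * L * d * exp (k * τ) := by
      rw [← norm_eq_abs]
      refine intervalIntegral.norm_integral_le_of_norm_le hr0 ?_ ?_
      · exact Eventually.of_forall fun τ hτ => hJb τ ⟨hτ.1.le, hτ.2⟩
      · exact (by fun_prop : Continuous fun τ => R * L * d * exp (k * τ)).intervalIntegrable _ _
    have h3 : ∫ τ in (0 : ℝ)..r, R * L * d * exp (k * τ)
        = R * L * d / k * exp (k * r) - R * L * d / k * exp (k * 0) := by
      refine intervalIntegral.integral_eq_sub_of_hasDerivAt
        (f := fun τ => R * L * d / k * exp (k * τ)) (fun τ _ => ?_) ?_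
      · refine ((((hasDerivAt_id τ).const_mul k).exp).const_mul (R * L * d / k)).congr_deriv ?_
        simp only [id]
        field_simp
      · exact (by fun_prop : Continuous fun τ => R * L * d * exp (k * τ)).intervalIntegrable _ _
    have h4 : 0 ≤ R * L * d / k * exp (k * 0) := by positivity
    have h5 : R * L * d / k ≤ 1 / 2 * d := by
      rw [div_le_iff₀ hk0]
      nlinarith
    rw [h1]
    calc exp (-(k * r)) * |∫ τ in (0 : ℝ)..r, (radialMean N (g y₂) τ - radialMean N (g y₁) τ)|
        ≤ exp (-(k * r)) * (R * L * d / k * exp (k * r)) := by gcongr; linarith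
      _ = R * L * d / k := by
        rw [mul_left_comm, ← exp_add]; simp
      _ ≤ _ := by simpa using h5
  obtain ⟨y, hy, -⟩ := hcontr.exists_fixedPoint 0 (edist_ne_top _ _)
  refine ⟨fun r => β - ∫ τ in (0 : ℝ)..r, radialMean N (g y) τ, fun r => -radialMean N (g y) r,
    continuous_const.sub (hIc y), (hJ y).neg, by simp, by simp [radialMean_zero], fun r hr => ?_⟩
  refine ⟨(hI y r).const_sub β, ?_⟩
  refine (hasDerivAt_radialMean N (hg y) hr.1.ne').neg.congr_deriv ?_
  have h1 : y ⟨r, hr.1.le, hr.2⟩ = exp (-(k * r)) * (β - ∫ τ in (0 : ℝ)..r, radialMean N (g y) τ) := by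
    rw [← hT y ⟨r, hr.1.le, hr.2⟩, hy]
  have h2 : g y r = G r (β - ∫ τ in (0 : ℝ)..r, radialMean N (g y) τ) := by
    change G r (exp (k * r) * IccExtend hR y r) = _
    rw [IccExtend_of_mem hR y ⟨hr.1.le, hr.2⟩, h1, ← mul_assoc, ← exp_add]
    simp
  rw [← h2]
  ring

end Existence

section Dependence

variable {N : ℕ} {p z : ℝ} {u u' v v' w w' : ℝ → ℝ}

/-- Gronwall's inequality for radial second order equations: the friction term has a good sign. -/
theorem radial_gronwall {K η : ℝ} (hK : 0 ≤ K) (hη : 0 ≤ η) {x x' g : ℝ → ℝ}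
    (hx : ContinuousOn x (Icc 0 z)) (hx' : ContinuousOn x' (Icc 0 z))
    (hd : ∀ r ∈ Ioc 0 z, HasDerivAt x (x' r) r)
    (hd' : ∀ r ∈ Ioc 0 z, HasDerivAt x' (-((N : ℝ) + 1) / r * x' r - g r) r)
    (hg : ∀ r ∈ Ioc 0 z, |g r| ≤ K * |x r| + η) (h0 : x' 0 = 0) {r : ℝ} (hr : r ∈ Icc 0 z) :
    |x r| ≤ exp ((K + 2) * z) * (|x 0| + η) ∧ |x' r| ≤ exp ((K + 2) * z) * (|x 0| + η) := by
  have hz : 0 ≤ z := hr.1.trans hr.2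
  have hanti := antitoneOn_Icc_of_hasDerivAt (a := 0) (b := z)
    (G := fun r => exp (-((K + 2) * r)) * (x r ^ 2 + x' r ^ 2 + η ^ 2)) (by fun_prop)
    (fun r hr => (((hasDerivAt_id r).const_mul (K + 2)).neg.exp).mul
      ((((hd r ⟨hr.1, hr.2.le⟩).pow 2).add ((hd' r ⟨hr.1, hr.2.le⟩).pow 2)).add_const (η ^ 2)))
    (fun r hr => by
      simp only [id, Pi.add_apply, Pi.pow_apply, Pi.neg_apply]
      have hE := exp_pos (-((K + 2) * r))
      have h1 := hg r ⟨hr.1, hr.2.le⟩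
      have h2 : 0 ≤ ((N : ℝ) + 1) / r * x' r ^ 2 := by
        have := hr.1
        positivity
      have h3 : -(x' r * g r) ≤ |x' r| * (K * |x r| + η) := by
        calc -(x' r * g r) ≤ |x' r * g r| := neg_le_abs _
          _ = |x' r| * |g r| := abs_mul _ _
          _ ≤ _ := by gcongr
      have h4 : x r * x' r ≤ |x r| * |x' r| := by rw [← abs_mul]; exact le_abs_self _
      have h5 : x r ^ 2 = |x r| ^ 2 := (sq_abs _).symm
      have h6 : x' r ^ 2 = |x' r| ^ 2 := (sq_abs _).symm
      have key : 2 * (x r * x' r) + 2 * (x' r * (-((N : ℝ) + 1) / r * x' r - g r))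
          ≤ (K + 2) * (x r ^ 2 + x' r ^ 2 + η ^ 2) := by
        have e : x' r * (-((N : ℝ) + 1) / r * x' r - g r)
            = -(((N : ℝ) + 1) / r * x' r ^ 2) - x' r * g r := by ring
        rw [e, h5, h6]
        rw [h6] at h2
        have := mul_nonneg hK (sq_nonneg (|x r| - |x' r|))
        have h7 := mul_nonneg hK (sq_nonneg η)
        nlinarith [sq_nonneg (|x r| - |x' r|), sq_nonneg (η - |x' r|), sq_nonneg |x r|]
      have := mul_le_mul_of_nonneg_left key hE.le
      rw [show 2 - 1 = 1 from rfl]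
      push_cast
      linarith)
  have h1 := hanti (left_mem_Icc.2 hz) hr hr.1
  simp only [mul_zero, neg_zero, exp_zero, one_mul, h0] at h1
  have h2 : exp (-((K + 2) * z)) ≤ exp (-((K + 2) * r)) := exp_le_exp.2 (by nlinarith [hr.2])
  have h3 : x r ^ 2 + x' r ^ 2 + η ^ 2 ≤ exp ((K + 2) * z) * (x 0 ^ 2 + η ^ 2) := by
    have h4 : exp (-((K + 2) * z)) * (x r ^ 2 + x' r ^ 2 + η ^ 2) ≤ x 0 ^ 2 + η ^ 2 := by
      have := mul_le_mul_of_nonneg_right h2 (by positivity : 0 ≤ x r ^ 2 + x' r ^ 2 + η ^ 2)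
      linarith
    have := mul_le_mul_of_nonneg_left h4 (exp_pos ((K + 2) * z)).le
    rwa [← mul_assoc, ← exp_add, add_neg_cancel, exp_zero, one_mul] at this
  have h5 : 1 ≤ exp ((K + 2) * z) := one_le_exp (by positivity)
  have h6 : exp ((K + 2) * z) * (x 0 ^ 2 + η ^ 2) ≤ (exp ((K + 2) * z) * (|x 0| + η)) ^ 2 := by
    rw [mul_pow, ← sq_abs (x 0)]
    have := abs_nonneg (x 0)
    have h7 : |x 0| ^ 2 + η ^ 2 ≤ (|x 0| + η) ^ 2 := by nlinarith [mul_nonneg this hη]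
    have h8 : exp ((K + 2) * z) ≤ exp ((K + 2) * z) ^ 2 := by nlinarith
    gcongr
  constructor
  · apply abs_le_of_sq_le_sq _ (by positivity)
    nlinarith [sq_nonneg (x' r), sq_nonneg η]
  · apply abs_le_of_sq_le_sq _ (by positivity)
    nlinarith [sq_nonneg (x r), sq_nonneg η]

theorem RadialSol.energy_le (hp : 1 < p) (h : RadialSol N p z u u') {r : ℝ} (hr : r ∈ Icc 0 z) :
    u' r ^ 2 - u r ^ 2 + 2 / (p + 1) * (|u r| ^ (p - 1) * u r ^ 2)
      ≤ -u 0 ^ 2 + 2 / (p + 1) * (|u 0| ^ (p - 1) * u 0 ^ 2) := by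
  have hp1 : p + 1 ≠ 0 := by linarith
  have c1 := h.cont
  have c2 := h.cont'
  have c3 : ContinuousOn (fun r => |u r| ^ (p - 1)) (Icc 0 z) :=
    (continuous_abs_rpow (sub_pos.2 hp)).comp_continuousOn c1
  have hanti := antitoneOn_Icc_of_hasDerivAt (a := 0) (b := z)
    (G := fun r => u' r ^ 2 - u r ^ 2 + 2 / (p + 1) * (|u r| ^ (p - 1) * u r ^ 2)) (by fun_prop)
    (fun r hr => (((h.deriv' r ⟨hr.1, hr.2.le⟩).pow 2).sub ((h.deriv r ⟨hr.1, hr.2.le⟩).pow 2)).add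
      (((hasDerivAt_abs_rpow_mul_sq hp (u r)).comp r (h.deriv r ⟨hr.1, hr.2.le⟩)).const_mul
        (2 / (p + 1)))) (fun r hr => by
      have hr0 := hr.1
      have : 0 ≤ ((N : ℝ) + 1) / r * u' r ^ 2 := by positivity
      refine le_of_eq_of_le (b := -2 * (((N : ℝ) + 1) / r * u' r ^ 2)) ?_ (by linarith)
      simp only [f]
      field_simp
      ring)
  have := hanti (left_mem_Icc.2 (hr.1.trans hr.2)) hr hr.1
  simp only [h.zero'] at this
  linarith

/-- A bound for all solutions with initial values in a bounded interval. -/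
theorem exists_radialSol_bound (hp : 1 < p) {α : ℝ} (hα : 0 ≤ α) : ∃ M : ℝ, 0 < M ∧
    ∀ (N : ℕ) (z : ℝ) (u u' : ℝ → ℝ), RadialSol N p z u u' → u 0 ∈ Icc 0 α →
      ∀ r ∈ Icc 0 z, |u r| < M := by
  have hp1 : 0 < p - 1 := by linarith
  have hp2 : 0 < p + 1 := by linarith
  set C := 2 / (p + 1) * (α ^ (p - 1) * α ^ 2) with hC
  have hC0 : 0 ≤ C := by
    have : 0 ≤ α ^ (p - 1) := rpow_nonneg hα _
    positivity
  set T := (p + 1) / 2 * (C + 2) with hT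
  have hT0 : 0 < T := by positivity
  refine ⟨max 1 (T ^ (1 / (p - 1))), by positivity, fun N z u u' h h0 r hr => ?_⟩
  by_contra hlt
  push Not at hlt
  have h1 : 1 ≤ |u r| := (le_max_left _ _).trans hlt
  have h2 : T ≤ |u r| ^ (p - 1) := by
    have := rpow_le_rpow (rpow_nonneg hT0.le _) ((le_max_right _ _).trans hlt) hp1.le
    rwa [← rpow_mul hT0.le, one_div_mul_cancel hp1.ne', rpow_one] at this
  have h3 : C + 2 ≤ 2 / (p + 1) * |u r| ^ (p - 1) := by
    have := mul_le_mul_of_nonneg_left h2 (by positivity : 0 ≤ 2 / (p + 1))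
    refine le_trans (le_of_eq ?_) this
    rw [hT]; field_simp
  have h4 : |u 0| ^ (p - 1) * u 0 ^ 2 ≤ α ^ (p - 1) * α ^ 2 := by
    rw [abs_of_nonneg h0.1]
    have := rpow_le_rpow h0.1 h0.2 hp1.le
    have h5 := pow_le_pow_left₀ h0.1 h0.2 2
    have h6 := rpow_nonneg hα (p - 1)
    gcongr
  have h5 := h.energy_le hp hr
  have h6 : 2 / (p + 1) * (|u 0| ^ (p - 1) * u 0 ^ 2) ≤ C :=
    mul_le_mul_of_nonneg_left h4 (by positivity)
  have h7 : 1 ≤ u r ^ 2 := by rw [← sq_abs]; exact one_le_pow₀ h1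
  have h8 : (C + 2) * u r ^ 2 ≤ 2 / (p + 1) * |u r| ^ (p - 1) * u r ^ 2 :=
    mul_le_mul_of_nonneg_right h3 (sq_nonneg _)
  nlinarith [sq_nonneg (u' r), sq_nonneg (u 0)]

theorem exists_f_lipschitz (hp : 1 < p) (M : ℝ) : ∃ K : ℝ, 0 ≤ K ∧
    (∀ s ∈ Icc (-M) M, |fder p s| ≤ K) ∧
    ∀ a ∈ Icc (-M) M, ∀ b ∈ Icc (-M) M, |f p a - f p b| ≤ K * |a - b| := by
  obtain ⟨C, hC⟩ := (isCompact_Icc (a := -M) (b := M)).exists_bound_of_continuousOn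
    (continuous_fder hp).continuousOn
  have hb : ∀ s ∈ Icc (-M) M, |fder p s| ≤ max C 0 := fun s hs => (hC s hs).trans (le_max_left _ _)
  refine ⟨max C 0, le_max_right _ _, hb, fun a ha b hb' => ?_⟩
  exact (convex_Icc (-M) M).norm_image_sub_le_of_norm_hasDerivWithin_le
    (fun s _ => (hasDerivAt_f hp s).hasDerivWithinAt) hb hb' ha

theorem f_linearization (hp : 1 < p) (M : ℝ) {ε : ℝ} (hε : 0 < ε) : ∃ δ > 0,
    ∀ a ∈ Icc (-M) M, ∀ b ∈ Icc (-M) M, |b - a| < δ →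
      |f p b - f p a - fder p a * (b - a)| ≤ ε * |b - a| := by
  have huc := (isCompact_Icc (a := -M) (b := M)).uniformContinuousOn_of_continuous
    (continuous_fder hp).continuousOn
  obtain ⟨δ, hδ, hd⟩ := Metric.uniformContinuousOn_iff.1 huc ε hε
  refine ⟨δ, hδ, fun a ha b hb hab => ?_⟩
  have hsub : uIcc a b ⊆ Icc (-M) M := uIcc_subset_Icc ha hb
  have := (convex_uIcc a b).norm_image_sub_le_of_norm_hasDerivWithin_le
    (f := fun s => f p s - fder p a * s) (f' := fun s => fder p s - fder p a) (C := ε)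
    (fun s _ => (((hasDerivAt_f hp s).sub
      ((hasDerivAt_id s).const_mul (fder p a))).congr_deriv (by rw [mul_one])).hasDerivWithinAt)
    (fun s hs => by
      have h1 : |s - a| ≤ |b - a| := abs_sub_left_of_mem_uIcc hs
      have := hd s (hsub hs) a ha (by rw [dist_eq]; exact h1.trans_lt hab)
      rw [dist_eq] at this
      exact this.le) left_mem_uIcc right_mem_uIcc
  simp only [norm_eq_abs] at this
  convert this using 2
  ring

theorem clamp_mem_Icc {a b : ℝ} (hab : a ≤ b) (s : ℝ) : max a (min b s) ∈ Icc a b :=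
  ⟨le_max_left _ _, max_le hab (min_le_left _ _)⟩

theorem clamp_eq {a b s : ℝ} (hs : s ∈ Icc a b) : max a (min b s) = s := by
  rw [min_eq_right hs.2, max_eq_right hs.1]

theorem abs_clamp_sub_le (a b s t : ℝ) : |max a (min b s) - max a (min b t)| ≤ |s - t| := by
  have h1 := abs_max_sub_max_le_max a (min b s) a (min b t)
  have h2 := abs_min_sub_min_le_max b s b t
  simp only [sub_self, abs_zero] at h1 h2
  rw [max_eq_right (abs_nonneg (min b s - min b t))] at h1
  rw [max_eq_right (abs_nonneg (s - t))] at h2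
  exact h1.trans h2

/-- Existence for the initial value problem. -/
theorem exists_radialSol (N : ℕ) (hp : 1 < p) (hz : 0 ≤ z) {β : ℝ} (hβ : 0 ≤ β) :
    ∃ u u' : ℝ → ℝ, RadialSol N p z u u' ∧ u 0 = β := by
  obtain ⟨M, hM, hbound⟩ := exists_radialSol_bound hp hβ
  obtain ⟨K, hK, -, hlip⟩ := exists_f_lipschitz hp M
  have hMM : -M ≤ M := by linarith
  obtain ⟨u, u', hu, hu', h0, h0', hd⟩ := exists_radial_solution N hz
    (G := fun _ w => f p (max (-M) (min M w))) ((continuous_f hp).comp (by fun_prop)) hK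
    (fun s a b => (hlip _ (clamp_mem_Icc hMM a) _ (clamp_mem_Icc hMM b)).trans
      (mul_le_mul_of_nonneg_left (abs_clamp_sub_le _ _ _ _) hK)) β
  have hsol : ∀ y ≤ z, (∀ r ∈ Icc 0 y, |u r| ≤ M) → RadialSol N p y u u' := fun y hy hb =>
    { cont := hu.continuousOn
      cont' := hu'.continuousOn
      deriv := fun r hr => (hd r ⟨hr.1, hr.2.trans hy⟩).1
      deriv' := fun r hr => by
        have h1 := (hd r ⟨hr.1, hr.2.trans hy⟩).2
        rwa [clamp_eq (abs_le.1 (hb r ⟨hr.1.le, hr.2⟩))] at h1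
      zero' := h0' }
  have hβ' : u 0 ∈ Icc 0 β := by rw [h0]; exact ⟨hβ, le_rfl⟩
  refine ⟨u, u', hsol z le_rfl ?_, h0⟩
  by_contra hcon
  push Not at hcon
  obtain ⟨r₁, hr₁, hM₁⟩ := hcon
  have hcomp : IsCompact (Icc 0 z ∩ {r | M ≤ |u r|}) :=
    isCompact_Icc.inter_right (isClosed_le continuous_const hu.abs)
  obtain ⟨r₀, ⟨hr₀, hM₀⟩, hleast⟩ := hcomp.exists_isLeast ⟨r₁, hr₁, hM₁.le⟩
  have hzero : |u 0| < M := by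
    have h1 : RadialSol N p 0 u u' :=
      { cont := hu.continuousOn
        cont' := hu'.continuousOn
        deriv := fun r hr => absurd hr.1 (not_lt.2 hr.2)
        deriv' := fun r hr => absurd hr.1 (not_lt.2 hr.2)
        zero' := h0' }
    exact hbound N 0 u u' h1 hβ' 0 ⟨le_rfl, le_rfl⟩
  obtain ⟨r₂, hr₂, hM₂⟩ := intermediate_value_Icc hr₀.1 hu.abs.continuousOn
    (show M ∈ Icc |u 0| |u r₀| from ⟨hzero.le, hM₀⟩)
  have h2 : ∀ r ∈ Icc 0 r₂, |u r| ≤ M := by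
    intro r hr
    rcases hr.2.eq_or_lt with rfl | hlt
    · exact hM₂.le
    · by_contra hc
      push Not at hc
      have := hleast ⟨⟨hr.1, hr.2.trans (hr₂.2.trans hr₀.2)⟩, hc.le⟩
      linarith [hr₂.2]
  have := hbound N r₂ u u' (hsol r₂ (hr₂.2.trans hr₀.2) h2) hβ' r₂ ⟨hr₂.1, le_rfl⟩
  exact this.ne hM₂

/-- Existence for the linearized equation. -/
theorem RadialSol.exists_radialVar (hp : 1 < p) (hz : 0 ≤ z) (h : RadialSol N p z u u') :
    ∃ v v' : ℝ → ℝ, RadialVar N p z u v v' := by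
  have hc : Continuous fun s => fder p (u (max 0 (min z s))) :=
    (continuous_fder hp).comp (h.cont.comp_continuous (by fun_prop) (clamp_mem_Icc hz))
  obtain ⟨C, hC⟩ := (isCompact_Icc (a := 0) (b := z)).exists_bound_of_continuousOn hc.continuousOn
  have hC0 : 0 ≤ C := (norm_nonneg _).trans (hC 0 ⟨le_rfl, hz⟩)
  have hb : ∀ s, |fder p (u (max 0 (min z s)))| ≤ C := fun s => by
    have := hC _ (clamp_mem_Icc hz s)
    rwa [clamp_eq (clamp_mem_Icc hz s)] at this
  obtain ⟨v, v', hv, hv', h0, h0', hd⟩ := exists_radial_solution N hz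
    (G := fun s w => fder p (u (max 0 (min z s))) * w)
    ((hc.comp continuous_fst).mul continuous_snd) hC0
    (fun s a b => by
      rw [← mul_sub, abs_mul]
      exact mul_le_mul_of_nonneg_right (hb s) (abs_nonneg _)) 1
  exact ⟨v, v',
    { cont := hv.continuousOn
      cont' := hv'.continuousOn
      deriv := fun r hr => (hd r hr).1
      deriv' := fun r hr => by
        have h1 := (hd r hr).2
        rwa [clamp_eq ⟨hr.1.le, hr.2⟩] at h1
      zero := h0
      zero' := h0' }⟩

/-- Lipschitz dependence on the initial value. -/
theorem radialSol_lipschitz {M K : ℝ} (hK : 0 ≤ K)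
    (hlip : ∀ a ∈ Icc (-M) M, ∀ b ∈ Icc (-M) M, |f p a - f p b| ≤ K * |a - b|)
    (hu : RadialSol N p z u u') (hw : RadialSol N p z w w') (hMu : ∀ r ∈ Icc 0 z, |u r| ≤ M)
    (hMw : ∀ r ∈ Icc 0 z, |w r| ≤ M) {r : ℝ} (hr : r ∈ Icc 0 z) :
    |w r - u r| ≤ exp ((K + 2) * z) * |w 0 - u 0| ∧
      |w' r - u' r| ≤ exp ((K + 2) * z) * |w 0 - u 0| := by
  have := radial_gronwall (N := N) (η := 0) (x := fun r => w r - u r) (x' := fun r => w' r - u' r)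
    (g := fun r => f p (w r) - f p (u r)) hK le_rfl (hw.cont.sub hu.cont) (hw.cont'.sub hu.cont')
    (fun r hr => (hw.deriv r hr).sub (hu.deriv r hr))
    (fun r hr => ((hw.deriv' r hr).sub (hu.deriv' r hr)).congr_deriv (by ring))
    (fun r hr => by
      rw [add_zero]
      have hr' := Ioc_subset_Icc_self hr
      exact hlip _ (abs_le.1 (hMw r hr')) _ (abs_le.1 (hMu r hr')))
    (by simp [hw.zero', hu.zero']) hr
  simpa using this

/-- The variation is the derivative with respect to the initial value. -/
theorem radialSol_hasDeriv (hp : 1 < p) {M : ℝ} (hz : 0 ≤ z) (hu : RadialSol N p z u u')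
    (hMu : ∀ r ∈ Icc 0 z, |u r| ≤ M) (hv : RadialVar N p z u v v') {ε : ℝ} (hε : 0 < ε) :
    ∃ δ > 0, ∀ w w' : ℝ → ℝ, RadialSol N p z w w' → (∀ r ∈ Icc 0 z, |w r| ≤ M) →
      |w 0 - u 0| < δ → |w z - u z - (w 0 - u 0) * v z| ≤ ε * |w 0 - u 0| := by
  obtain ⟨K, hK, hKb, hlip⟩ := exists_f_lipschitz hp M
  set E := exp ((K + 2) * z) with hE
  have hE0 : 0 < E := exp_pos _
  obtain ⟨δ, hδ, hlin⟩ := f_linearization hp M (show 0 < ε / E ^ 2 by positivity)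
  refine ⟨δ / E, by positivity, fun w w' hw hMw hd => ?_⟩
  have hclose : ∀ r ∈ Icc 0 z, |w r - u r| ≤ E * |w 0 - u 0| := fun r hr =>
    (radialSol_lipschitz hK hlip hu hw hMu hMw hr).1
  rw [lt_div_iff₀ hE0] at hd
  have := (radial_gronwall (N := N) (η := ε / E * |w 0 - u 0|)
    (x := fun r => w r - u r - (w 0 - u 0) * v r)
    (x' := fun r => w' r - u' r - (w 0 - u 0) * v' r)
    (g := fun r => f p (w r) - f p (u r) - (w 0 - u 0) * (fder p (u r) * v r)) hK (by positivity)
    ((hw.cont.sub hu.cont).sub (hv.cont.const_mul _))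
    ((hw.cont'.sub hu.cont').sub (hv.cont'.const_mul _))
    (fun r hr => ((hw.deriv r hr).sub (hu.deriv r hr)).sub ((hv.deriv r hr).const_mul _))
    (fun r hr => (((hw.deriv' r hr).sub (hu.deriv' r hr)).sub
      ((hv.deriv' r hr).const_mul _)).congr_deriv (by ring))
    (fun r hr => by
      have hr' := Ioc_subset_Icc_self hr
      have h1 := hclose r hr'
      have h2 := hlin _ (abs_le.1 (hMu r hr')) _ (abs_le.1 (hMw r hr')) (by linarith)
      have h3 := hKb _ (abs_le.1 (hMu r hr'))
      have h4 : ε / E ^ 2 * |w r - u r| ≤ ε / E * |w 0 - u 0| := by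
        have := mul_le_mul_of_nonneg_left h1 (by positivity : 0 ≤ ε / E ^ 2)
        refine this.trans_eq ?_
        field_simp
      have e : f p (w r) - f p (u r) - (w 0 - u 0) * (fder p (u r) * v r)
          = fder p (u r) * (w r - u r - (w 0 - u 0) * v r)
            + (f p (w r) - f p (u r) - fder p (u r) * (w r - u r)) := by ring
      rw [e]
      refine (abs_add_le _ _).trans (add_le_add ?_ (h2.trans h4))
      rw [abs_mul]
      gcongr)
    (by simp [hw.zero', hu.zero', hv.zero']) (right_mem_Icc.2 hz)).1
  refine this.trans_eq ?_
  rw [hv.zero, ← hE]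
  simp only [mul_one, sub_self, abs_zero, zero_add]
  field_simp

/-- A solution and its derivative do not vanish simultaneously. -/
theorem RadialSol.ne_zero_or_deriv_ne_zero (hp : 1 < p) (h : RadialSol N p z u u')
    (h0 : u 0 ≠ 0) {y : ℝ} (hy : y ∈ Ioc 0 z) : u y ≠ 0 ∨ u' y ≠ 0 := by
  by_contra hcon
  push Not at hcon
  obtain ⟨hu, hu'⟩ := hcon
  replace h := h.mono hy.2
  obtain ⟨M, hM⟩ := (isCompact_Icc (a := 0) (b := y)).exists_bound_of_continuousOn h.cont
  obtain ⟨K, hK, -, hlip⟩ := exists_f_lipschitz hp M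
  have hM0 : 0 ≤ M := (norm_nonneg _).trans (hM 0 ⟨le_rfl, hy.1.le⟩)
  have hf0 : f p 0 = 0 := by simp [f]
  have c1 := h.cont
  have c2 := h.cont'
  have hmono := monotoneOn_Icc_of_hasDerivAt (a := 0) (b := y)
    (G := fun r => exp ((K + 1) * r) * (r ^ (2 * (N + 1)) * (u r ^ 2 + u' r ^ 2))) (by fun_prop)
    (fun r hr => (((hasDerivAt_id r).const_mul (K + 1)).exp).mul
      ((hasDerivAt_pow (2 * (N + 1)) r).mul
        (((h.deriv r ⟨hr.1, hr.2.le⟩).pow 2).add ((h.deriv' r ⟨hr.1, hr.2.le⟩).pow 2))))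
    (fun r hr => by
      have hr0 := hr.1
      have hr0' : r ≠ 0 := hr0.ne'
      simp only [id, Pi.add_apply, Pi.pow_apply, Pi.mul_apply]
      have h1 : |f p (u r)| ≤ K * |u r| := by
        have := hlip (u r) (abs_le.1 (hM r (Ioo_subset_Icc_self hr))) 0 ⟨by linarith, hM0⟩
        rwa [hf0, sub_zero, sub_zero] at this
      have h3 : u' r * f p (u r) ≤ |u' r| * (K * |u r|) := by
        calc u' r * f p (u r) ≤ |u' r * f p (u r)| := le_abs_self _
          _ = |u' r| * |f p (u r)| := abs_mul _ _
          _ ≤ _ := by gcongr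
      have h4 : -(u r * u' r) ≤ |u r| * |u' r| := by rw [← abs_mul]; exact neg_le_abs _
      have h5 : u r ^ 2 = |u r| ^ 2 := (sq_abs _).symm
      have h6 : u' r ^ 2 = |u' r| ^ 2 := (sq_abs _).symm
      have key : 0 ≤ (K + 1) * (u r ^ 2 + u' r ^ 2) + 2 * (u r * u' r)
          - 2 * (u' r * f p (u r)) := by
        rw [h5, h6]
        have := mul_nonneg hK (sq_nonneg (|u r| - |u' r|))
        nlinarith [sq_nonneg (|u r| - |u' r|)]
      have h7 : 0 ≤ 2 * ((N : ℝ) + 1) / r * u r ^ 2 := by positivity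
      have h8 := mul_nonneg (mul_pos (exp_pos ((K + 1) * r)) (pow_pos hr0 (2 * (N + 1)))).le
        (add_nonneg key h7)
      refine h8.trans_eq ?_
      have e : r ^ (2 * (N + 1)) = r ^ (2 * (N + 1) - 1) * r := by
        rw [← pow_succ]
        congr 1
      rw [e]
      push_cast
      field_simp
      ring)
  have hzero : ∀ r ∈ Ioc 0 y, u r = 0 := by
    intro r hr
    have h1 := hmono (Ioc_subset_Icc_self hr) (right_mem_Icc.2 hy.1.le) hr.2
    simp only [hu, hu'] at h1
    have h2 : 0 < exp ((K + 1) * r) * r ^ (2 * (N + 1)) :=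
      mul_pos (exp_pos _) (pow_pos hr.1 _)
    by_contra hne
    have h3 := mul_pos h2 (by positivity : 0 < u r ^ 2 + u' r ^ 2)
    linarith
  obtain ⟨δ, hδ, hd⟩ := exists_pos_near_zero hy.1 h.cont.abs (abs_pos.2 h0)
  have := hd δ (right_mem_Icc.2 hδ.1.le)
  rw [hzero δ hδ, abs_zero] at this
  exact this.false

end Dependence

section Phase

/-- A function which is initially at least `c` and crosses the level `c` only upwards ends up
above `c`. -/
theorem lt_of_upward_crossing {a b c : ℝ} (hab : a < b) {Φ : ℝ → ℝ}
    (hΦ : ContinuousOn Φ (Icc a b)) (ha : c ≤ Φ a)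
    (hright : ∀ x ∈ Ico a b, Φ x = c → ∃ y ∈ Ioc x b, ∀ t ∈ Ioc x y, c < Φ t)
    (hleft : ∀ x ∈ Ioc a b, Φ x = c → ∀ y ∈ Ico a x, ∃ t ∈ Ioo y x, Φ t < c) : c < Φ b := by
  obtain ⟨y, hy, hyc⟩ : ∃ y ∈ Ioc a b, ∀ t ∈ Ioc a y, c < Φ t := by
    rcases ha.eq_or_lt with h | h
    · exact hright a ⟨le_rfl, hab⟩ h.symm
    · have h1 := (hΦ a (left_mem_Icc.2 hab.le)).eventually (lt_mem_nhds h)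
      rw [nhdsWithin_Icc_eq_nhdsGE hab] at h1
      obtain ⟨y, hy, hys⟩ := mem_nhdsGE_iff_exists_Icc_subset.1 h1
      refine ⟨min y b, ⟨lt_min hy hab, min_le_right _ _⟩, fun t ht => ?_⟩
      exact hys ⟨ht.1.le, ht.2.trans (min_le_left _ _)⟩
  by_contra! hcon
  have hsub : Icc y b ⊆ Icc a b := Icc_subset_Icc_left hy.1.le
  have hcl : IsCompact {t ∈ Icc y b | Φ t ∈ Iic c} :=
    isCompact_Icc.of_isClosed_subset
      ((hΦ.mono hsub).preimage_isClosed_of_isClosed isClosed_Icc isClosed_Iic) (fun t ht => ht.1)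
  obtain ⟨x, ⟨hx, hxc⟩, hleast⟩ := hcl.exists_isLeast ⟨b, right_mem_Icc.2 hy.2, hcon⟩
  have hyx : y < x := lt_of_le_of_ne hx.1 (by
    rintro rfl
    exact absurd (hyc y ⟨hy.1, le_rfl⟩) (not_lt.2 hxc))
  have hbelow : ∀ t ∈ Ico y x, c < Φ t := fun t ht => by
    by_contra! h
    exact absurd (hleast ⟨⟨ht.1, ht.2.le.trans hx.2⟩, h⟩) (not_le.2 ht.2)
  have hxc' : Φ x = c := by
    refine le_antisymm hxc ?_
    by_contra! h
    obtain ⟨t, ht, htc⟩ := intermediate_value_Icc' hyx.le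
      (hΦ.mono (Icc_subset_Icc hy.1.le hx.2)) ⟨h.le, (hyc y ⟨hy.1, le_rfl⟩).le⟩
    rcases ht.2.eq_or_lt with h1 | h1
    · rw [h1] at htc
      exact h.ne htc
    · exact (hbelow t ⟨ht.1, h1⟩).ne' htc
  obtain ⟨t, ht, htc⟩ := hleft x ⟨hy.1.trans hyx, hx.2⟩ hxc' y ⟨hy.1.le, hyx⟩
  exact (hbelow t ⟨ht.1.le, ht.2⟩).not_gt htc

/-- `θ` is a continuous phase of `u` on `[0, R]`: zeros of `u` are zeros of `cos θ`, and `θ`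
increases strictly through them. -/
structure IsPhase (R : ℝ) (u θ : ℝ → ℝ) : Prop where
  cont : Continuous θ
  zero : θ 0 = 0
  eq_zero_iff : ∀ r ∈ Icc 0 R, u r = 0 ↔ cos (θ r) = 0
  deriv : ∀ r ∈ Ioc 0 R, u r = 0 → ∃ d > 0, HasDerivAt θ d r

variable {R : ℝ} {u θ : ℝ → ℝ}

theorem IsPhase.lt_of_le (h : IsPhase R u θ) {x y c : ℝ} (hx : 0 ≤ x) (hxy : x < y) (hy : y ≤ R)
    (hc : cos c = 0) (hxc : c ≤ θ x) : c < θ y := by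
  have key : ∀ t ∈ Icc x y, θ t = c → ∃ d > 0, HasDerivAt θ d t := by
    intro t ht htc
    have ht0 : 0 ≤ t := hx.trans ht.1
    refine h.deriv t ⟨lt_of_le_of_ne ht0 ?_, ht.2.trans hy⟩
      ((h.eq_zero_iff t ⟨ht0, ht.2.trans hy⟩).2 (by rw [htc, hc]))
    rintro rfl
    rw [← htc, h.zero, cos_zero] at hc
    exact one_ne_zero hc
  refine lt_of_upward_crossing hxy h.cont.continuousOn hxc ?_ ?_
  · intro t ht htc
    obtain ⟨d, hd, hderiv⟩ := key t ⟨ht.1, ht.2.le⟩ htc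
    have h1 := (hasDerivAt_iff_tendsto_slope.1 hderiv).eventually (lt_mem_nhds hd)
    have h2 := h1.filter_mono (nhdsWithin_mono t (fun s (hs : s ∈ Ioi t) => ne_of_gt hs))
    obtain ⟨s, hs, hsub⟩ := mem_nhdsGT_iff_exists_Ioc_subset.1 h2
    refine ⟨min s y, ⟨lt_min hs ht.2, min_le_right _ _⟩, fun q hq => ?_⟩
    have h3 : 0 < slope θ t q := hsub ⟨hq.1, hq.2.trans (min_le_left _ _)⟩
    rw [slope_def_field, htc] at h3
    have h4 := (div_pos_iff_of_pos_right (sub_pos.2 hq.1)).1 h3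
    linarith
  · intro t ht htc s hs
    obtain ⟨d, hd, hderiv⟩ := key t ⟨ht.1.le, ht.2⟩ htc
    have h1 := (hasDerivAt_iff_tendsto_slope.1 hderiv).eventually (lt_mem_nhds hd)
    have h2 := h1.filter_mono (nhdsWithin_mono t (fun s (hs : s ∈ Iio t) => ne_of_lt hs))
    obtain ⟨q, hq, hq'⟩ := (h2.and (Ioo_mem_nhdsLT hs.2)).exists
    refine ⟨q, hq', ?_⟩
    rw [slope_def_field, htc] at hq
    have h3 : q - t < 0 := sub_neg.2 hq'.2
    by_contra! h4
    exact absurd hq (not_lt.2 (div_nonpos_of_nonneg_of_nonpos (by linarith) h3.le))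

theorem cos_nat_mul_pi_add_pi_div_two (k : ℕ) : cos (k * π + π / 2) = 0 :=
  cos_eq_zero_iff.2 ⟨k, by push_cast; ring⟩

theorem IsPhase.exists_eq (h : IsPhase R u θ) {r : ℝ} (hr : r ∈ Ioc 0 R) (hu : u r = 0) :
    ∃ k : ℕ, θ r = k * π + π / 2 := by
  obtain ⟨k, hk⟩ := cos_eq_zero_iff.1 ((h.eq_zero_iff r ⟨hr.1.le, hr.2⟩).1 hu)
  have h1 : -(π / 2) < θ r := h.lt_of_le le_rfl hr.1 hr.2 (by rw [cos_neg, cos_pi_div_two])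
    (by rw [h.zero]; linarith [pi_pos])
  have h2 : 0 ≤ k := by
    by_contra! h3
    have h4 : (k : ℝ) ≤ -1 := by exact_mod_cast Int.le_sub_one_of_lt h3
    rw [hk] at h1
    nlinarith [pi_pos]
  lift k to ℕ using h2
  exact ⟨k, by rw [hk]; push_cast; ring⟩

/-- A level is attained at most once. -/
theorem IsPhase.eq_of_eq (h : IsPhase R u θ) {x y c : ℝ} (hx : x ∈ Icc 0 R) (hy : y ∈ Icc 0 R)
    (hc : cos c = 0) (hxc : θ x = c) (hyc : θ y = c) : x = y := by
  rcases lt_trichotomy x y with hxy | hxy | hxy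
  · exact absurd hyc (h.lt_of_le hx.1 hxy hy.2 hc hxc.ge).ne'
  · exact hxy
  · exact absurd hxc (h.lt_of_le hy.1 hxy hx.2 hc hyc.ge).ne'

/-- The `i`-th zero is where the phase attains `(i + 1/2) π`. -/
theorem IsPhase.firstZeros_eq {j : ℕ} {z : Fin (j + 1) → ℝ} (h : IsPhase (z (Fin.last j)) u θ)
    (hz : FirstZeros u (j + 1) z) (i : Fin (j + 1)) : θ (z i) = (i : ℕ) * π + π / 2 := by
  have hmem : ∀ i, z i ∈ Ioc 0 (z (Fin.last j)) := fun i =>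
    ⟨(hz.2.1 i).1, hz.1.monotone (Fin.le_last i)⟩
  have hmem' : ∀ i, z i ∈ Icc 0 (z (Fin.last j)) := fun i => Ioc_subset_Icc_self (hmem i)
  suffices H : ∀ m : ℕ, ∀ i : Fin (j + 1), (i : ℕ) = m → θ (z i) = (i : ℕ) * π + π / 2 from
    H i i rfl
  intro m
  induction m using Nat.strong_induction_on with
  | _ m ih =>
    intro i him
    obtain ⟨k, hk⟩ := h.exists_eq (hmem i) (hz.2.1 i).2
    rcases lt_trichotomy k (i : ℕ) with hki | hki | hki
    · have h1 := ih k (him ▸ hki) ⟨k, hki.trans i.2⟩ rfl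
      have h2 := h.eq_of_eq (hmem' _) (hmem' _) (cos_nat_mul_pi_add_pi_div_two k) h1 hk
      have h3 := congrArg Fin.val (hz.1.injective h2)
      simp only at h3
      omega
    · rw [hk, hki]
    · have h0 : ((i : ℕ) : ℝ) * π + π / 2 < k * π + π / 2 := by
        have : ((i : ℕ) : ℝ) < k := by exact_mod_cast hki
        nlinarith [pi_pos]
      have hpos : 0 < ((i : ℕ) : ℝ) * π + π / 2 := by positivity
      obtain ⟨r, hr, hrc⟩ := intermediate_value_Ioo (hmem i).1.le h.cont.continuousOn
        (show ((i : ℕ) : ℝ) * π + π / 2 ∈ Ioo (θ 0) (θ (z i)) by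
          rw [h.zero, hk]; exact ⟨hpos, h0⟩)
      have hr' : r ∈ Icc 0 (z (Fin.last j)) := ⟨hr.1.le, hr.2.le.trans (hmem i).2⟩
      have hur : u r = 0 := (h.eq_zero_iff r hr').2 (by
        rw [hrc]; exact cos_nat_mul_pi_add_pi_div_two _)
      rcases hz.2.2 r hr.1 hur with ⟨l, hl⟩ | hl
      · have hli : l < i := hz.1.lt_iff_lt.1 (hl ▸ hr.2)
        have h1 := ih l (by rw [← him]; exact hli) l rfl
        rw [← hl, hrc] at h1
        have h2 : ((i : ℕ) : ℝ) = (l : ℕ) :=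
          mul_right_cancel₀ pi_pos.ne' (by linarith)
        have h3 : (i : ℕ) = l := by exact_mod_cast h2
        have h4 : (l : ℕ) < i := hli
        omega
      · exact absurd (hl i) (not_lt.2 hr.2.le)

/-- If the phase at `z i` exceeds `(i + 1/2) π`, then the `i`-th zero lies to the left of `z i`. -/
theorem IsPhase.exists_firstZeros {j : ℕ} {z : Fin (j + 1) → ℝ} (hz : StrictMono z)
    (hz0 : ∀ i, 0 < z i) (h : IsPhase (z (Fin.last j)) u θ)
    (hθ : ∀ i : Fin (j + 1), ((i : ℕ) : ℝ) * π + π / 2 < θ (z i)) :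
    ∃ w : Fin (j + 1) → ℝ, FirstZeros u (j + 1) w ∧ ∀ i, w i < z i := by
  have hex : ∀ i : Fin (j + 1), ∃ r ∈ Ioo 0 (z i), θ r = (i : ℕ) * π + π / 2 := fun i =>
    intermediate_value_Ioo (hz0 i).le h.cont.continuousOn
      ⟨by rw [h.zero]; positivity, hθ i⟩
  choose w hw hwθ using hex
  have hle : ∀ i, z i ≤ z (Fin.last j) := fun i => hz.monotone (Fin.le_last i)
  have hwR : ∀ i, w i ∈ Icc 0 (z (Fin.last j)) := fun i =>
    ⟨(hw i).1.le, (hw i).2.le.trans (hle i)⟩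
  have hcomp : ∀ i : Fin (j + 1), ∀ r ∈ Icc 0 (z (Fin.last j)),
      ((i : ℕ) : ℝ) * π + π / 2 < θ r → w i < r := by
    intro i r hr hir
    by_contra! hcon
    rcases hcon.eq_or_lt with h1 | h1
    · rw [h1, hwθ] at hir
      exact lt_irrefl _ hir
    · have h2 := h.lt_of_le hr.1 h1 (hwR i).2 (cos_nat_mul_pi_add_pi_div_two i) hir.le
      rw [hwθ] at h2
      exact lt_irrefl _ h2
  refine ⟨w, ⟨fun a b hab => ?_, fun i => ⟨(hw i).1, ?_⟩, fun r hr hur => ?_⟩, fun i => (hw i).2⟩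
  · refine hcomp a _ (hwR b) ?_
    rw [hwθ]
    have : ((a : ℕ) : ℝ) < (b : ℕ) := by exact_mod_cast hab
    nlinarith [pi_pos]
  · rw [h.eq_zero_iff _ (hwR i), hwθ]
    exact cos_nat_mul_pi_add_pi_div_two i
  · rcases le_or_gt r (z (Fin.last j)) with hrR | hrR
    · obtain ⟨k, hk⟩ := h.exists_eq ⟨hr, hrR⟩ hur
      rcases lt_or_ge k (j + 1) with hkj | hkj
      · exact Or.inl ⟨⟨k, hkj⟩, h.eq_of_eq ⟨hr.le, hrR⟩ (hwR _)
          (cos_nat_mul_pi_add_pi_div_two k) hk (hwθ _)⟩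
      · refine Or.inr fun i => hcomp i r ⟨hr.le, hrR⟩ ?_
        rw [hk]
        have : ((i : ℕ) : ℝ) < k := by exact_mod_cast i.2.trans_le hkj
        nlinarith [pi_pos]
    · exact Or.inr fun i => ((hw i).2.trans_le (hle i)).trans hrR

/-- A planar curve solving a linear system of rotation and dilation type, in polar form. -/
theorem polar_form {X Y P T : ℝ → ℝ} (hP : Continuous P) (hT : Continuous T)
    (hX : ContinuousOn X (Icc 0 R)) (hY : ContinuousOn Y (Icc 0 R))
    (hX' : ∀ r ∈ Ioo 0 R, HasDerivAt X (P r * X r + T r * Y r) r)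
    (hY' : ∀ r ∈ Ioo 0 R, HasDerivAt Y (P r * Y r - T r * X r) r) (hY0 : Y 0 = 0)
    {r : ℝ} (hr : r ∈ Icc 0 R) :
    X r = X 0 * exp (∫ s in (0 : ℝ)..r, P s) * cos (∫ s in (0 : ℝ)..r, T s) ∧
      Y r = -(X 0 * exp (∫ s in (0 : ℝ)..r, P s) * sin (∫ s in (0 : ℝ)..r, T s)) := by
  set q : ℝ → ℝ := fun r => ∫ s in (0 : ℝ)..r, P s with hq
  set θ : ℝ → ℝ := fun r => ∫ s in (0 : ℝ)..r, T s with hθ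
  have dq : ∀ r, HasDerivAt q (P r) r := fun r => hP.integral_hasStrictDerivAt 0 r |>.hasDerivAt
  have dθ : ∀ r, HasDerivAt θ (T r) r := fun r => hT.integral_hasStrictDerivAt 0 r |>.hasDerivAt
  have cq : Continuous q := continuous_iff_continuousAt.2 fun r => (dq r).continuousAt
  have cθ : Continuous θ := continuous_iff_continuousAt.2 fun r => (dθ r).continuousAt
  have q0 : q 0 = 0 := intervalIntegral.integral_same
  have θ0 : θ 0 = 0 := intervalIntegral.integral_same
  have hconst : ∀ G : ℝ → ℝ, ContinuousOn G (Icc 0 R) → (∀ r ∈ Ioo 0 R, HasDerivAt G 0 r) →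
      G r = G 0 := by
    intro G hc hd
    have h0 : (0 : ℝ) ∈ Icc 0 R := left_mem_Icc.2 (hr.1.trans hr.2)
    exact le_antisymm
      (antitoneOn_Icc_of_hasDerivAt (G' := fun _ => 0) hc hd (fun _ _ => le_rfl) h0 hr hr.1)
      (monotoneOn_Icc_of_hasDerivAt (G' := fun _ => 0) hc hd (fun _ _ => le_rfl) h0 hr hr.1)
  have e1 := hconst (fun r => exp (-q r) * (X r * cos (θ r) - Y r * sin (θ r))) (by fun_prop) (by
    intro r hr
    refine ((dq r).neg.exp.mul (((hX' r hr).mul (dθ r).cos).sub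
      ((hY' r hr).mul (dθ r).sin))).congr_deriv ?_
    simp only [Pi.mul_apply, Pi.sub_apply, Pi.neg_apply]
    ring)
  have e2 := hconst (fun r => exp (-q r) * (X r * sin (θ r) + Y r * cos (θ r))) (by fun_prop) (by
    intro r hr
    refine ((dq r).neg.exp.mul (((hX' r hr).mul (dθ r).sin).add
      ((hY' r hr).mul (dθ r).cos))).congr_deriv ?_
    simp only [Pi.mul_apply, Pi.add_apply, Pi.neg_apply]
    ring)
  simp only [q0, θ0, hY0, neg_zero, exp_zero, cos_zero, sin_zero, mul_one, mul_zero, one_mul,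
    sub_zero, add_zero] at e1 e2
  have e3 : exp (q r) * exp (-q r) = 1 := by rw [← exp_add, add_neg_cancel, exp_zero]
  have e4 := sin_sq_add_cos_sq (θ r)
  have e5 : X r * cos (θ r) - Y r * sin (θ r) = X 0 * exp (q r) := by
    rw [← e1]; linear_combination (-(X r * cos (θ r) - Y r * sin (θ r))) * e3
  have e6 : X r * sin (θ r) + Y r * cos (θ r) = 0 :=
    (mul_eq_zero.1 e2).resolve_left (exp_pos _).ne'
  constructor
  · linear_combination cos (θ r) * e5 + sin (θ r) * e6 - X r * e4
  · linear_combination -sin (θ r) * e5 + cos (θ r) * e6 - Y r * e4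

end Phase

section Family

variable {N : ℕ} {p a b R : ℝ} {U U' : ℝ → ℝ → ℝ}

/-- A family of solutions parametrized by the initial value has a phase which depends continuously
on the initial value. -/
theorem exists_phase (hp : 1 < p) (hR : 0 ≤ R) (ha : 0 < a) (hab : a ≤ b)
    (hU : ∀ β ∈ Icc a b, RadialSol N p R (U β) (U' β)) (hU0 : ∀ β ∈ Icc a b, U β 0 = β) :
    ∃ θ A : ℝ → ℝ → ℝ, (∀ r, Continuous fun β => θ β r) ∧ ∀ β ∈ Icc a b,
      IsPhase R (U β) (θ β) ∧ (∀ r, 0 < A β r) ∧ ∀ r ∈ Icc 0 R, U β r = A β r * cos (θ β r) ∧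
        r ^ (N + 1) * U' β r = -(A β r * sin (θ β r)) := by
  obtain ⟨M, -, hM⟩ := exists_radialSol_bound hp (ha.le.trans hab)
  obtain ⟨K, hK, -, hlip⟩ := exists_f_lipschitz hp M
  have hMU : ∀ β ∈ Icc a b, ∀ r ∈ Icc 0 R, |U β r| ≤ M := fun β hβ r hr =>
    (hM N R _ _ (hU β hβ) (by rw [hU0 β hβ]; exact ⟨ha.le.trans hβ.1, hβ.2⟩) r hr).le
  have hLip : ∀ β ∈ Icc a b, ∀ γ ∈ Icc a b, ∀ r ∈ Icc 0 R,
      |U β r - U γ r| ≤ exp ((K + 2) * R) * |β - γ| ∧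
        |U' β r - U' γ r| ≤ exp ((K + 2) * R) * |β - γ| := by
    intro β hβ γ hγ r hr
    have := radialSol_lipschitz hK hlip (hU γ hγ) (hU β hβ) (hMU γ hγ) (hMU β hβ) hr
    rwa [hU0 β hβ, hU0 γ hγ] at this
  have joint : ∀ V : ℝ → ℝ → ℝ, (∀ β ∈ Icc a b, ContinuousOn (V β) (Icc 0 R)) →
      (∀ β ∈ Icc a b, ∀ γ ∈ Icc a b, ∀ r ∈ Icc 0 R,
        |V β r - V γ r| ≤ exp ((K + 2) * R) * |β - γ|) →
      Continuous fun x : ℝ × ℝ => V (max a (min b x.1)) (max 0 (min R x.2)) := by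
    intro V hc hl
    refine continuous_prod_of_continuous_lipschitzWith _ ⟨exp ((K + 2) * R), (exp_pos _).le⟩
      (fun β => ?_) (fun r => ?_)
    · exact (hc _ (clamp_mem_Icc hab β)).comp_continuous (by fun_prop) (clamp_mem_Icc hR)
    · refine LipschitzWith.of_dist_le_mul fun β γ => ?_
      rw [Real.dist_eq, Real.dist_eq]
      exact (hl _ (clamp_mem_Icc hab β) _ (clamp_mem_Icc hab γ) _ (clamp_mem_Icc hR r)).trans
        (mul_le_mul_of_nonneg_left (abs_clamp_sub_le _ _ _ _) (exp_pos _).le)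
  have cX := joint U (fun β hβ => (hU β hβ).cont) (fun β hβ γ hγ r hr => (hLip β hβ γ hγ r hr).1)
  have cX' := joint U' (fun β hβ => (hU β hβ).cont')
    (fun β hβ γ hγ r hr => (hLip β hβ γ hγ r hr).2)
  set X : ℝ × ℝ → ℝ := fun x => U (max a (min b x.1)) (max 0 (min R x.2)) with hX
  set X' : ℝ × ℝ → ℝ := fun x => U' (max a (min b x.1)) (max 0 (min R x.2)) with hX'
  set ρ : ℝ × ℝ → ℝ := fun x => max 0 (min R x.2) ^ (N + 1) with hρ
  have cρ : Continuous ρ := by fun_prop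
  have cf := (continuous_f hp).comp cX
  set D : ℝ × ℝ → ℝ := fun x => X x ^ 2 + (ρ x * X' x) ^ 2 with hD
  have hD0 : ∀ x, D x ≠ 0 := by
    intro x
    have hβ := clamp_mem_Icc hab x.1
    have hr := clamp_mem_Icc hR x.2
    have hβ0 : U (max a (min b x.1)) 0 ≠ 0 := by
      rw [hU0 _ hβ]
      exact (ha.trans_le hβ.1).ne'
    have hne : X x ≠ 0 ∨ ρ x * X' x ≠ 0 := by
      rcases hr.1.eq_or_lt with h | h
      · left
        simp only [hX, ← h]
        exact hβ0
      · rcases (hU _ hβ).ne_zero_or_deriv_ne_zero hp hβ0 ⟨h, hr.2⟩ with h1 | h1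
        · exact Or.inl h1
        · exact Or.inr (mul_ne_zero (pow_pos h _).ne' h1)
    rcases hne with h | h
    · have := sq_pos_of_ne_zero h
      positivity
    · have := sq_pos_of_ne_zero h
      positivity
  have cD : Continuous D := by fun_prop
  set T : ℝ → ℝ → ℝ := fun β s => (ρ (β, s) * X' (β, s) ^ 2 + X (β, s) * (ρ (β, s) * f p (X (β, s)))) /
    D (β, s) with hT
  set P : ℝ → ℝ → ℝ := fun β s => (X (β, s) * X' (β, s) -
    ρ (β, s) * X' (β, s) * (ρ (β, s) * f p (X (β, s)))) / D (β, s) with hP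
  have cT : Continuous (Function.uncurry T) :=
    ((cρ.mul (cX'.pow 2)).add (cX.mul (cρ.mul cf))).div cD hD0
  have cP : Continuous (Function.uncurry P) :=
    ((cX.mul cX').sub ((cρ.mul cX').mul (cρ.mul cf))).div cD hD0
  have cTβ : ∀ β, Continuous (T β) := fun β => cT.comp (by fun_prop : Continuous fun s => (β, s))
  have cPβ : ∀ β, Continuous (P β) := fun β => cP.comp (by fun_prop : Continuous fun s => (β, s))
  refine ⟨fun β r => ∫ s in (0 : ℝ)..r, T β s, fun β r => β * exp (∫ s in (0 : ℝ)..r, P β s),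
    fun r => intervalIntegral.continuous_parametric_intervalIntegral_of_continuous' cT 0 r,
    fun β hβ => ?_⟩
  have eX : ∀ r ∈ Icc 0 R, X (β, r) = U β r := fun r hr => by
    simp only [hX, clamp_eq hβ, clamp_eq hr]
  have eX' : ∀ r ∈ Icc 0 R, X' (β, r) = U' β r := fun r hr => by
    simp only [hX', clamp_eq hβ, clamp_eq hr]
  have eρ : ∀ r ∈ Icc 0 R, ρ (β, r) = r ^ (N + 1) := fun r hr => by
    simp only [hρ, clamp_eq hr]
  have hβ0 : 0 < β := ha.trans_le hβ.1
  have hpolar : ∀ r ∈ Icc 0 R, _ := fun r hr =>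
    polar_form (R := R) (X := U β) (Y := fun r => r ^ (N + 1) * U' β r) (cPβ β) (cTβ β)
      (hU β hβ).cont ((continuous_pow _).continuousOn.mul (hU β hβ).cont')
      (fun r hr => by
        have hr' := Ioo_subset_Icc_self hr
        refine ((hU β hβ).deriv r ⟨hr.1, hr.2.le⟩).congr_deriv ?_
        have hd := hD0 (β, r)
        simp only [hT, hP]
        rw [div_mul_eq_mul_div, div_mul_eq_mul_div, ← add_div, eq_div_iff hd]
        simp only [hD, eX r hr', eX' r hr', eρ r hr']
        ring)
      (fun r hr => by
        have hr' := Ioo_subset_Icc_self hr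
        refine ((hasDerivAt_pow (N + 1) r).mul
          ((hU β hβ).deriv' r ⟨hr.1, hr.2.le⟩)).congr_deriv ?_
        have hd := hD0 (β, r)
        have h0 : r ^ (N + 1) * (-((N : ℝ) + 1) / r * U' β r) = -((N : ℝ) + 1) * r ^ N * U' β r := by
          have := hr.1.ne'
          field_simp
          ring
        have h1 : ((N + 1 : ℕ) : ℝ) * r ^ (N + 1 - 1) * U' β r +
            r ^ (N + 1) * (-((N : ℝ) + 1) / r * U' β r - f p (U β r)) =
              -(r ^ (N + 1) * f p (U β r)) := by
          rw [mul_sub, h0, Nat.add_sub_cancel]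
          push_cast
          ring
        rw [h1]
        simp only [hT, hP]
        rw [div_mul_eq_mul_div, div_mul_eq_mul_div, ← sub_div, eq_div_iff hd]
        simp only [hD, eX r hr', eX' r hr', eρ r hr']
        ring)
      (by simp) hr
  simp only [hU0 β hβ] at hpolar
  have hA : ∀ r, 0 < β * exp (∫ s in (0 : ℝ)..r, P β s) := fun r => mul_pos hβ0 (exp_pos _)
  refine ⟨⟨?_, intervalIntegral.integral_same, fun r hr => ?_, fun r hr hur => ?_⟩, hA, hpolar⟩
  · exact intervalIntegral.continuous_primitive (fun _ _ => (cTβ β).intervalIntegrable _ _) 0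
  · rw [(hpolar r hr).1]
    exact ⟨fun h => (mul_eq_zero.1 h).resolve_left (hA r).ne', fun h => by rw [h, mul_zero]⟩
  · refine ⟨T β r, ?_, ((cTβ β).integral_hasStrictDerivAt 0 r).hasDerivAt⟩
    have hr' := Ioc_subset_Icc_self hr
    have hne : U' β r ≠ 0 :=
      ((hU β hβ).ne_zero_or_deriv_ne_zero hp (by rw [hU0 β hβ]; exact hβ0.ne') hr).resolve_left
        (not_not.2 hur)
    simp only [hT, hD, eX r hr', eX' r hr', eρ r hr', hur]
    have h1 : 0 < r ^ (N + 1) := pow_pos hr.1 _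
    have h2 := sq_pos_of_ne_zero hne
    have h3 : 0 < (r ^ (N + 1) * U' β r) ^ 2 := sq_pos_of_ne_zero (mul_ne_zero h1.ne' hne)
    have h4 := mul_pos h1 h2
    rw [zero_mul, add_zero, zero_pow two_ne_zero, zero_add]
    exact div_pos h4 h3

/-- The solution starting from a slightly different initial value, near a zero of a given one. -/
theorem mul_variation_pos (hp : 1 < p) (hR : 0 ≤ R) (ha : 0 ≤ a)
    (hU : ∀ β ∈ Icc a b, RadialSol N p R (U β) (U' β)) (hU0 : ∀ β ∈ Icc a b, U β 0 = β)
    {β : ℝ} (hβ : β ∈ Icc a b) {v v' : ℝ → ℝ} (hv : RadialVar N p R (U β) v v')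
    (hvR : v R ≠ 0) (hzero : U β R = 0) :
    ∃ δ > 0, ∀ γ ∈ Icc a b, γ ≠ β → |γ - β| < δ → 0 < (γ - β) * v R * U γ R := by
  obtain ⟨M, -, hM⟩ := exists_radialSol_bound hp (ha.trans (hβ.1.trans hβ.2))
  have hMU : ∀ β ∈ Icc a b, ∀ r ∈ Icc 0 R, |U β r| ≤ M := fun β hβ r hr =>
    (hM N R _ _ (hU β hβ) (by rw [hU0 β hβ]; exact ⟨ha.trans hβ.1, hβ.2⟩) r hr).le
  have hε : 0 < |v R| / 2 := by positivity
  obtain ⟨δ, hδ, h⟩ := radialSol_hasDeriv hp hR (hU β hβ) (hMU β hβ) hv hε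
  refine ⟨δ, hδ, fun γ hγ hne hlt => ?_⟩
  have h1 := h _ _ (hU γ hγ) (hMU γ hγ) (by rwa [hU0 β hβ, hU0 γ hγ])
  rw [hU0 β hβ, hU0 γ hγ, hzero, sub_zero] at h1
  have h2 : 0 < |γ - β| * |v R| := mul_pos (abs_pos.2 (sub_ne_zero.2 hne)) (abs_pos.2 hvR)
  rw [← abs_mul] at h2
  set x := (γ - β) * v R with hx
  have h3 : |U γ R - x| ≤ |x| / 2 := by
    rw [hx, abs_mul]
    linarith
  have h4 := abs_le.1 h3
  rcases lt_or_gt_of_ne (abs_pos.1 h2) with h5 | h5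
  · rw [abs_of_neg h5] at h4
    exact mul_pos_of_neg_of_neg h5 (by linarith)
  · rw [abs_of_pos h5] at h4
    exact mul_pos h5 (by linarith)

/-- The phase at a fixed radius crosses the zero levels only upwards as the initial value
increases. -/
theorem phase_lt_phase (hp : 1 < p) (hN : 1 ≤ N) (hNp : (N : ℝ) * (p - 1) < 4) (ha : 0 < a)
    (hab : a < b) (hU : ∀ β ∈ Icc a b, RadialSol N p R (U β) (U' β))
    (hU0 : ∀ β ∈ Icc a b, U β 0 = β) {θ A : ℝ → ℝ → ℝ} (cθ : ∀ r, Continuous fun β => θ β r)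
    (hA : ∀ β ∈ Icc a b, ∀ r, 0 < A β r)
    (hθ : ∀ β ∈ Icc a b, ∀ r ∈ Icc 0 R, U β r = A β r * cos (θ β r) ∧
        r ^ (N + 1) * U' β r = -(A β r * sin (θ β r)))
    {z c : ℝ} (hz : z ∈ Ioc 0 R) (hc : cos c = 0) (hac : θ a z = c) : c < θ b z := by
  have hz' := Ioc_subset_Icc_self hz
  have key : ∀ β ∈ Icc a b, θ β z = c → ∃ δ > 0, ∀ γ ∈ Icc a b, γ ≠ β → |γ - β| < δ →
      0 < (γ - β) * (θ γ z - c) := by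
    intro β hβ hβc
    have hu : U β z = 0 := by rw [(hθ β hβ z hz').1, hβc, hc, mul_zero]
    have hUz : ∀ β ∈ Icc a b, RadialSol N p z (U β) (U' β) := fun β hβ => (hU β hβ).mono hz.2
    have hβ0 : 0 < U β 0 := by rw [hU0 β hβ]; exact ha.trans_le hβ.1
    obtain ⟨v, v', hv⟩ := (hUz β hβ).exists_radialVar hp hz.1.le
    have hne : U' β z ≠ 0 := ((hU β hβ).ne_zero_or_deriv_ne_zero hp hβ0.ne' hz).resolve_left
      (not_not.2 hu)
    have hsign := variation_sign hp (hUz β hβ) hv hN hNp hz.1 hβ0 hu hne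
    have hzN : 0 < z ^ (N + 1) := pow_pos hz.1 _
    have hsv : sin c * v z < 0 := by
      have h1 := (hθ β hβ z hz').2
      rw [hβc] at h1
      have h2 := mul_pos hzN hsign
      rw [← mul_assoc, h1] at h2
      by_contra! h3
      have h4 := mul_nonneg (hA β hβ z).le h3
      linarith
    obtain ⟨δ, hδ, hd⟩ := mul_variation_pos hp hz.1.le ha.le hUz hU0 hβ hv
      (right_ne_zero_of_mul hsign.ne') hu
    obtain ⟨δ', hδ', hd'⟩ := Metric.continuousAt_iff.1 ((cθ z).continuousAt (x := β)) π pi_pos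
    refine ⟨min δ δ', lt_min hδ hδ', fun γ hγ hne hlt => ?_⟩
    have h1 := hd γ hγ hne (hlt.trans_le (min_le_left _ _))
    have h2 := hd' (show dist γ β < δ' from hlt.trans_le (min_le_right _ _))
    rw [Real.dist_eq, hβc] at h2
    have h3 : cos (θ γ z) = -(sin c * sin (θ γ z - c)) := by
      have := cos_add c (θ γ z - c)
      rw [add_sub_cancel, hc] at this
      rw [this]
      ring
    rw [(hθ γ hγ z hz').1, h3] at h1
    have h4 : 0 < A γ z * (-(sin c * v z)) := mul_pos (hA γ hγ z) (by linarith)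
    have h5 : 0 < (γ - β) * sin (θ γ z - c) := by
      refine pos_of_mul_pos_right (a := A γ z * (-(sin c * v z))) ?_ h4.le
      linarith
    have h6 := abs_lt.1 h2
    rcases lt_or_gt_of_ne (sub_ne_zero.2 hne) with h7 | h7
    · refine mul_pos_of_neg_of_neg h7 ?_
      by_contra! h8
      exact absurd h5 (not_lt.2 (mul_nonpos_of_nonpos_of_nonneg h7.le
        (sin_nonneg_of_nonneg_of_le_pi h8 h6.2.le)))
    · refine mul_pos h7 ?_
      by_contra! h8
      exact absurd h5 (not_lt.2 (mul_nonpos_of_nonneg_of_nonpos h7.le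
        (sin_nonpos_of_nonpos_of_neg_pi_le h8 h6.1.le)))
  refine lt_of_upward_crossing hab (Φ := fun β => θ β z) (cθ z).continuousOn hac.ge ?_ ?_
  · intro β hβ hβc
    obtain ⟨δ, hδ, hd⟩ := key β (Ico_subset_Icc_self hβ) hβc
    refine ⟨min (β + δ / 2) b, ⟨lt_min (by linarith) hβ.2, min_le_right _ _⟩, fun γ hγ => ?_⟩
    have h1 := hγ.2.trans (min_le_left _ _)
    have h2 := hd γ ⟨hβ.1.trans hγ.1.le, hγ.2.trans (min_le_right _ _)⟩ hγ.1.ne' (by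
      rw [abs_of_pos (sub_pos.2 hγ.1)]; linarith)
    have := (mul_pos_iff_of_pos_left (sub_pos.2 hγ.1)).1 h2
    exact sub_pos.1 this
  · intro β hβ hβc y hy
    obtain ⟨δ, hδ, hd⟩ := key β (Ioc_subset_Icc_self hβ) hβc
    obtain ⟨γ, hγ⟩ := exists_between (max_lt hy.2 (sub_lt_self β hδ))
    have hyγ : y < γ := (le_max_left _ _).trans_lt hγ.1
    have hδγ : β - δ < γ := (le_max_right _ _).trans_lt hγ.1
    refine ⟨γ, ⟨hyγ, hγ.2⟩, ?_⟩
    have h2 := hd γ ⟨hy.1.trans hyγ.le, hγ.2.le.trans hβ.2⟩ hγ.2.ne (by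
      rw [abs_of_neg (sub_neg.2 hγ.2)]; linarith)
    by_contra! h3
    have := mul_nonpos_of_nonpos_of_nonneg (sub_neg.2 hγ.2).le (sub_nonneg.2 h3)
    linarith

/-- Comparison of zeros for two radial solutions. -/
theorem exists_firstZeros_lt (hp : 1 < p) (hN : 1 ≤ N) (hNp : (N : ℝ) * (p - 1) < 4) (ha : 0 < a)
    (hab : a < b) {j : ℕ} {z : Fin (j + 1) → ℝ} {ub ub' u u' : ℝ → ℝ}
    (hub : RadialSol N p (z (Fin.last j)) ub ub') (hu : RadialSol N p (z (Fin.last j)) u u')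
    (hub0 : ub 0 = a) (hu0 : u 0 = b) (hz : FirstZeros ub (j + 1) z) :
    ∃ w : Fin (j + 1) → ℝ, FirstZeros u (j + 1) w ∧ ∀ i, w i < z i := by
  set R := z (Fin.last j) with hR
  have hR0 : 0 < R := (hz.2.1 _).1
  have hfam : ∀ β : ℝ, ∃ x : (ℝ → ℝ) × (ℝ → ℝ), (β = a → x = (ub, ub')) ∧ (β = b → x = (u, u')) ∧
      (β ∈ Icc a b → RadialSol N p R x.1 x.2 ∧ x.1 0 = β) := by
    intro β
    by_cases h1 : β = a
    · subst h1
      exact ⟨_, fun _ => rfl, fun h => absurd h hab.ne, fun _ => ⟨hub, hub0⟩⟩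
    · by_cases h2 : β = b
      · subst h2
        exact ⟨_, fun h => absurd h h1, fun _ => rfl, fun _ => ⟨hu, hu0⟩⟩
      · by_cases h3 : β ∈ Icc a b
        · obtain ⟨w, w', hw, hw0⟩ := exists_radialSol N hp hR0.le (ha.le.trans h3.1)
          exact ⟨(w, w'), fun h => absurd h h1, fun h => absurd h h2, fun _ => ⟨hw, hw0⟩⟩
        · exact ⟨(u, u'), fun h => absurd h h1, fun h => absurd h h2, fun h => absurd h h3⟩
  choose V hVa hVb hV using hfam
  have hV1 : ∀ β ∈ Icc a b, RadialSol N p R (V β).1 (V β).2 := fun β hβ => (hV β hβ).1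
  have hV0 : ∀ β ∈ Icc a b, (V β).1 0 = β := fun β hβ => (hV β hβ).2
  obtain ⟨θ, A, cθ, h⟩ := exists_phase (U := fun β => (V β).1) (U' := fun β => (V β).2)
    hp hR0.le ha hab.le hV1 hV0
  have hPa := (h a (left_mem_Icc.2 hab.le)).1
  have hPb := (h b (right_mem_Icc.2 hab.le)).1
  rw [hVa a rfl] at hPa
  rw [hVb b rfl] at hPb
  refine hPb.exists_firstZeros hz.1 (fun i => (hz.2.1 i).1) fun i => ?_
  exact phase_lt_phase hp hN hNp ha hab hV1 hV0 cθ (fun β hβ => (h β hβ).2.1)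
    (fun β hβ => (h β hβ).2.2) ⟨(hz.2.1 i).1, hz.1.monotone (Fin.le_last i)⟩
    (cos_nat_mul_pi_add_pi_div_two i) (hPa.firstZeros_eq hz i)

theorem IsSolution.radialSol {α : ℝ} {u u' u'' : ℝ → ℝ} (h : IsSolution (N + 2) p α u u' u'')
    (R : ℝ) : RadialSol N p R u u' where
  cont := fun r hr => ((h.hasDeriv1 r hr.1).mono Icc_subset_Ici_self).continuousWithinAt
  cont' := fun r hr => ((h.hasDeriv2 r hr.1).mono Icc_subset_Ici_self).continuousWithinAt
  deriv := fun r hr => (h.hasDeriv1 r hr.1.le).hasDerivAt (Ici_mem_nhds hr.1)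
  deriv' := fun r hr => by
    refine ((h.hasDeriv2 r hr.1.le).hasDerivAt (Ici_mem_nhds hr.1)).congr_deriv ?_
    have := h.ode r hr.1
    push_cast at this
    rw [neg_div]
    linear_combination this
  zero' := h.initDeriv

end Family

/-- zeros move strictly left as the initial value increases. -/
theorem statement2 (n : ℕ) (hn : 3 ≤ n) (p : ℝ) (hp1 : 1 < p)
    (hp2 : p < ((n : ℝ) + 2) / ((n : ℝ) - 2))
    (αbar α : ℝ) (hαbar : 0 < αbar) (hlt : αbar < α)
    (ub ub' ub'' u u' u'' : ℝ → ℝ)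
    (hub : IsSolution n p αbar ub ub' ub'')
    (hu : IsSolution n p α u u' u'')
    (j : ℕ) (z : Fin j → ℝ) (hz : FirstZeros ub j z) :
    ∃ w : Fin j → ℝ, FirstZeros u j w ∧ ∀ i, w i < z i := by
  obtain ⟨N, rfl⟩ : ∃ N, n = N + 2 := ⟨n - 2, by omega⟩
  have hN : 1 ≤ N := by omega
  have hNp : (N : ℝ) * (p - 1) < 4 := by
    have hN0 : (0 : ℝ) < N := by exact_mod_cast hN
    push_cast at hp2
    rw [add_sub_cancel_right, lt_div_iff₀ hN0] at hp2
    linarith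
  cases j with
  | zero => exact ⟨z, ⟨hz.1, fun i => i.elim0, fun _ _ _ => Or.inr fun i => i.elim0⟩, fun i => i.elim0⟩
  | succ j =>
    exact exists_firstZeros_lt hp1 hN hNp hαbar hlt (hub.radialSol _) (hu.radialSol _) hub.init
      hu.init hz
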